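/- arXiv:1904.12202 — 3 statements merged into one kernel-verified Lean document; each statement's English description precedes it below -/
import Mathlib

section
/- Let K be a field. The monoid algebra K[C_3] is semiprime: if α ∈ K[C_3] satisfies α β α = 0 for every β ∈ K[C_3], then α = 0. -/
namespace HK

/-- The generator `x_k` of the free monoid on `ZMod n` (indices taken mod `n`,
so `x_n` is the letter `0`). -/
def fx (n k : ℕ) : FreeMonoid (ZMod n) := FreeMonoid.of (k : ZMod n)

/-- The ascending word `x_a x_{a+1} ⋯ x_b` (empty if `b < a`). -/
def asc (n a b : ℕ) : FreeMonoid (ZMod n) :=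
  FreeMonoid.ofList ((List.range' a (b + 1 - a)).map fun k => (k : ZMod n))

/-- The descending word `x_a x_{a-1} ⋯ x_b` (empty if `a < b`). -/
def desc (n a b : ℕ) : FreeMonoid (ZMod n) :=
  FreeMonoid.ofList (((List.range' b (a + 1 - b)).map fun k => (k : ZMod n)).reverse)

/-- `x_a ⋯ x_b`: ascending if `a ≤ b`, descending otherwise. -/
def seg (n a b : ℕ) : FreeMonoid (ZMod n) := if a ≤ b then asc n a b else desc n a b

/-- The word `q_i = x_1 ⋯ x_i x_{n-1} x_{n-2} ⋯ x_{i+1}`. -/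
def qw (n i : ℕ) : FreeMonoid (ZMod n) := asc n 1 i * desc n (n - 1) (i + 1)

/-- `|u|_c`: the number of occurrences of the letter `c` in the word `u`. -/
def cnt (n : ℕ) (u : FreeMonoid (ZMod n)) (c : ZMod n) : ℕ :=
  (FreeMonoid.toList u).count c

/-- `w` is a factor of `v`. -/
def IsFactor {α : Type*} (w v : FreeMonoid α) : Prop := ∃ v₁ v₂, v = v₁ * w * v₂

/-- A word is reduced if it contains no factor of the forms (1)–(5). -/
def Reduced (n : ℕ) (w : FreeMonoid (ZMod n)) : Prop :=
  (∀ i : ℕ, 1 ≤ i → i ≤ n → ¬ IsFactor (fx n i * fx n i) w) ∧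
  (∀ i j : ℕ, 1 ≤ i → j ≤ n → 1 < j - i → j - i < n - 1 →
      ¬ IsFactor (fx n j * fx n i) w) ∧
  (∀ i j : ℕ, 1 ≤ i → i + 1 < j → j < n - 1 →
      ¬ IsFactor (fx n n * asc n 1 i * fx n j) w) ∧
  (∀ i : ℕ, ∀ u : FreeMonoid (ZMod n), 1 ≤ i → i ≤ n → u ≠ 1 →
      cnt n u (i : ZMod n) = 0 → cnt n u ((i : ZMod n) - 1) = 0 →
      ¬ IsFactor (fx n i * u * fx n i) w) ∧
  (∀ i : ℕ, ∀ u : FreeMonoid (ZMod n), 1 ≤ i → i ≤ n → u ≠ 1 →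
      cnt n u (i : ZMod n) = 0 → cnt n u ((i : ZMod n) + 1) = 0 →
      ¬ IsFactor (fx n i * u * fx n i) w)

/-- Membership in the set `A_i`. -/
def InA (n i : ℕ) (a : FreeMonoid (ZMod n)) : Prop :=
  ∃ (s : ℕ) (k : ℕ → ℕ),
    s ≤ i + 1 ∧
    (1 ≤ s → 1 ≤ k s ∧ k s ≤ s) ∧
    (∀ t, s + 1 ≤ t → t ≤ i + 1 → t < k t ∧ k t ≤ n - 1) ∧
    (∀ t, s + 1 ≤ t → t + 1 ≤ i + 1 → k t < k (t + 1)) ∧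
    ∃ p : FreeMonoid (ZMod n),
      p * a = (if s = 0 then 1 else seg n (k s) s) *
        ((List.range' (s + 1) (i + 1 - s)).map fun t => seg n (k t) t).prod

/-- Membership in the set `B_i`. -/
def InB (n i : ℕ) (b : FreeMonoid (ZMod n)) : Prop :=
  ∃ (r : ℕ) (I J : ℕ → ℕ),
    (∀ t, 1 ≤ t → t ≤ r → 1 ≤ I t ∧ I t < i + 1) ∧
    (∀ t, 1 ≤ t → t + 1 ≤ r → I (t + 1) < I t) ∧
    i + 1 < J 1 ∧
    (∀ t, 1 ≤ t → t + 1 ≤ r + 1 → J t < J (t + 1)) ∧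
    J (r + 1) ≤ n ∧
    ∃ p : FreeMonoid (ZMod n),
      b * p = ((List.range' 1 r).map fun t =>
          fx n n * asc n 1 (I t) * desc n (n - 1) (J t)).prod *
        (fx n n * desc n (n - 1) (J (r + 1)))

/-- The defining relations of the Hecke–Kiselman monoid of the oriented cycle. -/
def cnRel (n : ℕ) : FreeMonoid (ZMod n) → FreeMonoid (ZMod n) → Prop := fun w v =>
  (∃ a : ZMod n, w = FreeMonoid.of a * FreeMonoid.of a ∧ v = FreeMonoid.of a) ∨
  (∃ a b : ZMod n, b ≠ a + 1 ∧ a ≠ b + 1 ∧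
    w = FreeMonoid.of a * FreeMonoid.of b ∧ v = FreeMonoid.of b * FreeMonoid.of a) ∨
  (∃ a : ZMod n,
    (w = FreeMonoid.of a * FreeMonoid.of (a + 1) * FreeMonoid.of a ∨
     w = FreeMonoid.of (a + 1) * FreeMonoid.of a * FreeMonoid.of (a + 1)) ∧
    v = FreeMonoid.of a * FreeMonoid.of (a + 1))

/-- The Hecke–Kiselman monoid `C_n` of the oriented cycle of length `n`. -/
abbrev Cn (n : ℕ) := (conGen (cnRel n)).Quotient

/-- The canonical projection `F → C_n`. -/
def pr (n : ℕ) : FreeMonoid (ZMod n) →* Cn n := (conGen (cnRel n)).mk'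

/-- The ideal `I_i` of `C_n`. -/
def Iset (n i : ℕ) : Set (Cn n) :=
  {w | ¬ ∃ (u v : Cn n) (k : ℕ), 1 ≤ k ∧ u * w * v = (pr n (fx n n * qw n i)) ^ k}



open Polynomial

lemma sumZ {R : Type*} [AddCommMonoid R] (f : ZMod 3 → R) : ∑ x, f x = f 0 + f 1 + f 2 :=
  Fin.sum_univ_three f

lemma z3 (j s : ZMod 3) : s = j ∨ s = j + 1 ∨ s = j - 1 := by
  revert j s; decide

def g (j : ZMod 3) : Cn 3 := pr 3 (FreeMonoid.of j)

lemma rel_eq {w v : FreeMonoid (ZMod 3)} (h : cnRel 3 w v) : pr 3 w = pr 3 v :=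
  (Con.eq _).2 (ConGen.Rel.of _ _ h)

lemma g1 (j : ZMod 3) : g j * g j = g j := by
  have := rel_eq (w := FreeMonoid.of j * FreeMonoid.of j) (v := FreeMonoid.of j)
    (Or.inl ⟨j, rfl, rfl⟩)
  simpa [g] using this

lemma g2 (j : ZMod 3) : g j * (g (j+1) * g j) = g j * g (j+1) := by
  have := rel_eq (w := FreeMonoid.of j * FreeMonoid.of (j+1) * FreeMonoid.of j)
    (v := FreeMonoid.of j * FreeMonoid.of (j+1))
    (Or.inr (Or.inr ⟨j, Or.inl rfl, rfl⟩))
  simpa [g, mul_assoc] using this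

lemma g3 (j : ZMod 3) : g (j+1) * (g j * g (j+1)) = g j * g (j+1) := by
  have := rel_eq (w := FreeMonoid.of (j+1) * FreeMonoid.of j * FreeMonoid.of (j+1))
    (v := FreeMonoid.of j * FreeMonoid.of (j+1))
    (Or.inr (Or.inr ⟨j, Or.inr rfl, rfl⟩))
  simpa [g, mul_assoc] using this

def A : ℕ → ZMod 3 → Cn 3
  | 0, s => g s * g (s+1)
  | L+1, s => g s * A L (s+1)

def D : ℕ → ZMod 3 → Cn 3
  | 0, s => g s * g (s-1)
  | L+1, s => g s * D L (s-1)

lemma gg {M : Type*} [Monoid M] {a : M} (h : a * a = a) (x : M) : a * (a * x) = a * x := by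
  rw [← mul_assoc, h]

lemma gA0 (L : ℕ) (j : ZMod 3) : g j * A L j = A L j := by
  cases L <;> exact gg (g1 j) _

lemma gA1 (L : ℕ) (j : ZMod 3) : g j * A L (j+1) = A (L+1) j := rfl

lemma gA2 (L : ℕ) (j : ZMod 3) : g (j+1) * A L j = A L j := by
  cases L with
  | zero => exact g3 j
  | succ L =>
    show g (j+1) * (g j * A L (j+1)) = g j * A L (j+1)
    rw [← gA0 L (j+1)]
    simp only [← mul_assoc]
    rw [mul_assoc (g (j+1)), g3]

lemma gD0 (L : ℕ) (j : ZMod 3) : g j * D L j = D L j := by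
  cases L <;> exact gg (g1 j) _

lemma gD1 (L : ℕ) (j : ZMod 3) : g j * D L (j-1) = D (L+1) j := rfl

lemma gAx (L : ℕ) (j s : ZMod 3) : ∃ L' s', g j * A L s = A L' s' := by
  rcases z3 j s with rfl | rfl | rfl
  · exact ⟨_, _, gA0 _ _⟩
  · exact ⟨_, _, gA1 _ _⟩
  · have := gA2 L (j-1)
    rw [sub_add_cancel] at this
    exact ⟨_, _, this⟩

lemma gD2 (L : ℕ) : ∀ j : ZMod 3, ∃ L' s', g j * D L (j+1) = A L' s' := by
  induction L using Nat.twoStepInduction with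
  | zero =>
    intro j
    refine ⟨0, j, ?_⟩
    show g j * (g (j+1) * g (j+1-1)) = g j * g (j+1)
    rw [add_sub_cancel_right, g2]
  | one =>
    intro j
    refine ⟨1, j, ?_⟩
    show g j * (g (j+1) * (g (j+1-1) * g (j+1-1-1))) = g j * (g (j+1) * g (j+1+1))
    have e : j - 1 = j + 1 + 1 := by revert j; decide
    rw [add_sub_cancel_right, e]
    have := congrArg (· * g (j+1+1)) (g2 j)
    simpa only [mul_assoc] using this
  | more L ih _ =>
    intro j
    have e : j - 1 = j + 1 + 1 := by revert j; decide
    have h : g j * D (L+2) (j+1) = g j * (g (j+1) * D L (j+1+1)) := by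
      show g j * (g (j+1) * (g (j+1-1) * D L (j+1-1-1))) = _
      rw [add_sub_cancel_right, e]
      have := congrArg (· * D L (j+1+1)) (g2 j)
      simpa only [mul_assoc] using this
    obtain ⟨L', s', h'⟩ := ih (j+1)
    rw [h, h']
    exact gAx _ _ _

/-- Normal forms. -/
def nf : (Unit ⊕ ZMod 3) ⊕ ((ZMod 3 × ℕ) ⊕ (ZMod 3 × ℕ)) → Cn 3
  | .inl (.inl _) => 1
  | .inl (.inr j) => g j
  | .inr (.inl p) => D p.2 p.1
  | .inr (.inr p) => A p.2 p.1

lemma nf_surj : Function.Surjective nf := by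
  have key : ∀ w : FreeMonoid (ZMod 3), ∃ n, nf n = pr 3 w := by
    intro w
    induction w using FreeMonoid.inductionOn' with
    | one => exact ⟨.inl (.inl ()), by simp [nf]⟩
    | of_mul j w ih =>
      obtain ⟨n, hn⟩ := ih
      rw [map_mul, ← hn]
      change ∃ m, nf m = g j * nf n
      rcases n with (_ | s) | (⟨s, L⟩ | ⟨s, L⟩)
      · exact ⟨.inl (.inr j), by simp [nf]⟩
      · rcases z3 j s with rfl | rfl | rfl
        · exact ⟨.inl (.inr s), (g1 s).symm⟩
        · exact ⟨.inr (.inr (j, 0)), rfl⟩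
        · exact ⟨.inr (.inl (j, 0)), rfl⟩
      · rcases z3 j s with rfl | rfl | rfl
        · exact ⟨.inr (.inl (s, L)), (gD0 _ _).symm⟩
        · obtain ⟨L', s', h⟩ := gD2 L j
          exact ⟨.inr (.inr (s', L')), h.symm⟩
        · exact ⟨.inr (.inl (j, L+1)), rfl⟩
      · obtain ⟨L', s', h⟩ := gAx L j s
        exact ⟨.inr (.inr (s', L')), h.symm⟩
  intro m
  obtain ⟨w, rfl⟩ := Con.mk'_surjective m
  exact key w

/-- Universal property. -/
def lft {M : Type*} [Monoid M] (f : ZMod 3 → M) (h1 : ∀ j, f j * f j = f j)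
    (h2 : ∀ j, f j * f (j+1) * f j = f j * f (j+1))
    (h3 : ∀ j, f (j+1) * f j * f (j+1) = f j * f (j+1)) : Cn 3 →* M :=
  (conGen (cnRel 3)).lift (FreeMonoid.lift f) (by
    rw [Con.conGen_le]
    rintro w v (⟨a, rfl, rfl⟩ | ⟨a, b, hab, hba, rfl, rfl⟩ | ⟨a, rfl | rfl, rfl⟩)
    · simp [Con.ker_rel, h1]
    · have : b = a := by
        rcases z3 a b with h | h | h
        · exact h
        · exact absurd h hab
        · exact absurd (by rw [h, sub_add_cancel]) hba
      subst this; rfl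
    · simp [Con.ker_rel, h2]
    · simp [Con.ker_rel, h3])

lemma lft_g {M : Type*} [Monoid M] (f : ZMod 3 → M) (h1 h2 h3) (j : ZMod 3) :
    lft f h1 h2 h3 (g j) = f j := by
  show FreeMonoid.lift f (FreeMonoid.of j) = f j
  simp

noncomputable section

variable (K : Type*) [Field K]

def rhoF (j : ZMod 3) : Matrix (ZMod 3) (ZMod 3) K[X] :=
  Matrix.of fun a t => if t = j + 1 then (if a = j then X else 0) else if a = t then 1 else 0

def sigF (j : ZMod 3) : Matrix (ZMod 3) (ZMod 3) K[X] :=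
  Matrix.of fun a t => if a = j then (if t = j then 1 else if t = j - 1 then X else 0) else 0

def chiF (i j : ZMod 3) : K := if i = j then 1 else 0

def QA : Matrix (ZMod 3) (ZMod 3) K[X] :=
  Matrix.of fun e t => if t = e - 1 then 1 else if t = e then X else X ^ 2

def QD : Matrix (ZMod 3) (ZMod 3) K[X] :=
  Matrix.of fun e t => if t = e then 1 else if t = e - 1 then X else 0

lemma zz (P : ZMod 3 → Prop) (h0 : P 0) (h1 : P 1) (h2 : P 2) : ∀ j, P j := by
  intro j; fin_cases j
  exacts [h0, h1, h2]

lemma e11 : (1 : ZMod 3) + 1 = 2 := rfl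
lemma e21 : (2 : ZMod 3) + 1 = 0 := rfl
lemma e01 : (0 : ZMod 3) - 1 = 2 := rfl
lemma e2m : (2 : ZMod 3) - 1 = 1 := rfl
lemma em1 : (-1 : ZMod 3) = 2 := rfl
lemma d01 : (0 : ZMod 3) ≠ 1 := by decide
lemma d02 : (0 : ZMod 3) ≠ 2 := by decide
lemma d12 : (1 : ZMod 3) ≠ 2 := by decide

def rho : Cn 3 →* Matrix (ZMod 3) (ZMod 3) K[X] := lft (rhoF K)
  (by
    intro j; ext1 a b; revert j a b
    refine zz _ ?_ ?_ ?_ <;> refine zz _ ?_ ?_ ?_ <;> refine zz _ ?_ ?_ ?_ <;>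
    simp [rhoF, Matrix.mul_apply, sumZ, e11, e21, d01, d02, d12, d01.symm, d02.symm, d12.symm, em1])
  (by
    intro j; ext1 a b; revert j a b
    refine zz _ ?_ ?_ ?_ <;> refine zz _ ?_ ?_ ?_ <;> refine zz _ ?_ ?_ ?_ <;>
    simp [rhoF, Matrix.mul_apply, sumZ, e11, e21, d01, d02, d12, d01.symm, d02.symm, d12.symm, em1])
  (by
    intro j; ext1 a b; revert j a b
    refine zz _ ?_ ?_ ?_ <;> refine zz _ ?_ ?_ ?_ <;> refine zz _ ?_ ?_ ?_ <;>
    simp [rhoF, Matrix.mul_apply, sumZ, e11, e21, d01, d02, d12, d01.symm, d02.symm, d12.symm, em1])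

lemma sig0 (j : ZMod 3) : sigF K j * sigF K (j+1) = 0 := by
  ext1 a b; revert j a b
  refine zz _ ?_ ?_ ?_ <;> refine zz _ ?_ ?_ ?_ <;> refine zz _ ?_ ?_ ?_ <;>
  simp [sigF, Matrix.mul_apply, sumZ, e11, e21, e01, e2m, d01, d02, d12, d01.symm, d02.symm, d12.symm, em1]

def sig : Cn 3 →* Matrix (ZMod 3) (ZMod 3) K[X] := lft (sigF K)
  (by
    intro j; ext1 a b; revert j a b
    refine zz _ ?_ ?_ ?_ <;> refine zz _ ?_ ?_ ?_ <;> refine zz _ ?_ ?_ ?_ <;>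
    simp [sigF, Matrix.mul_apply, sumZ, e01, e2m, d01, d02, d12, d01.symm, d02.symm, d12.symm, em1])
  (by intro j; rw [sig0, zero_mul])
  (by intro j; rw [mul_assoc, sig0, mul_zero])

/-- character -/
def chi (i : ZMod 3) : Cn 3 →* K := lft (chiF K i)
  (by intro j; simp [chiF])
  (by revert i; refine zz _ ?_ ?_ ?_ <;> refine zz _ ?_ ?_ ?_ <;>
      simp [chiF, e11, e21, d01, d02, d12, d01.symm, d02.symm, d12.symm, em1])
  (by revert i; refine zz _ ?_ ?_ ?_ <;> refine zz _ ?_ ?_ ?_ <;>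
      simp [chiF, e11, e21, d01, d02, d12, d01.symm, d02.symm, d12.symm, em1])

/-- trivial character -/
def chi0 : Cn 3 →* K := lft (fun _ => 0) (by simp) (by simp) (by simp)

lemma chi_g (i j : ZMod 3) : chi K i (g j) = if i = j then 1 else 0 := lft_g _ _ _ _ _

lemma chi_A (i : ZMod 3) (L : ℕ) (s : ZMod 3) : chi K i (A L s) = 0 := by
  induction L generalizing s with
  | zero =>
    rw [A, map_mul, chi_g, chi_g]
    revert i s
    refine zz _ ?_ ?_ ?_ <;> refine zz _ ?_ ?_ ?_ <;>
      simp [chiF, e11, e21, d01, d02, d12, d01.symm, d02.symm, d12.symm, em1]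
  | succ L ih => rw [A, map_mul, ih, mul_zero]

lemma chi_D (i : ZMod 3) (L : ℕ) (s : ZMod 3) : chi K i (D L s) = 0 := by
  induction L generalizing s with
  | zero =>
    rw [D, map_mul, chi_g, chi_g]
    revert i s
    refine zz _ ?_ ?_ ?_ <;> refine zz _ ?_ ?_ ?_ <;>
      simp [chiF, e01, e2m, d01, d02, d12, d01.symm, d02.symm, d12.symm, em1]
  | succ L ih => rw [D, map_mul, ih, mul_zero]

lemma chi0_g (j : ZMod 3) : chi0 K (g j) = 0 := lft_g _ _ _ _ _

lemma chi0_A (L : ℕ) (s : ZMod 3) : chi0 K (A L s) = 0 := by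
  cases L <;> rw [A, map_mul, chi0_g, zero_mul]

lemma chi0_D (L : ℕ) (s : ZMod 3) : chi0 K (D L s) = 0 := by
  cases L <;> rw [D, map_mul, chi0_g, zero_mul]

lemma sig_A (L : ℕ) (s : ZMod 3) : sig K (A L s) = 0 := by
  induction L generalizing s with
  | zero => rw [A, map_mul, sig, lft_g, lft_g, sig0]
  | succ L ih => rw [A, map_mul, ih, mul_zero]

lemma rho_A (L : ℕ) (s : ZMod 3) :
    rho K (A L s) = Matrix.single s (s + 1 + L) (X ^ L) * QA K := by
  induction L generalizing s with
  | zero =>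
    rw [A, map_mul, rho, lft_g, lft_g]
    ext1 a b; revert s a b
    refine zz _ ?_ ?_ ?_ <;> refine zz _ ?_ ?_ ?_ <;> refine zz _ ?_ ?_ ?_ <;>
    simp [rhoF, QA, Matrix.single_apply, Matrix.mul_apply, sumZ, e11, e21, e01, e2m, d01, d02, d12, d01.symm, d02.symm, d12.symm, em1, sq]
  | succ L ih =>
    rw [A, map_mul, ih, ← mul_assoc]
    congr 1
    rw [rho, lft_g, show s + 1 + ((L + 1 : ℕ) : ZMod 3) = s + 1 + 1 + L by push_cast; ring]
    generalize s + 1 + 1 + (L : ZMod 3) = e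
    ext1 a b; revert s a
    refine zz _ ?_ ?_ ?_ <;> refine zz _ ?_ ?_ ?_ <;>
    simp [rhoF, Matrix.single_apply, Matrix.mul_apply, sumZ, e11, e21, e01, e2m, d01, d02, d12, d01.symm, d02.symm, d12.symm, em1, pow_succ']

lemma sig_D (L : ℕ) (s : ZMod 3) :
    sig K (D L s) = Matrix.single s (s - 1 - L) (X ^ (L+1)) * QD K := by
  induction L generalizing s with
  | zero =>
    rw [D, map_mul, sig, lft_g, lft_g]
    ext1 a b; revert s a b
    refine zz _ ?_ ?_ ?_ <;> refine zz _ ?_ ?_ ?_ <;> refine zz _ ?_ ?_ ?_ <;>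
    simp [sigF, QD, Matrix.single_apply, Matrix.mul_apply, sumZ, e11, e21, e01, e2m, d01, d02, d12, d01.symm, d02.symm, d12.symm, em1]
  | succ L ih =>
    rw [D, map_mul, ih, ← mul_assoc]
    congr 1
    rw [sig, lft_g, show s - 1 - ((L + 1 : ℕ) : ZMod 3) = s - 1 - 1 - L by push_cast; ring]
    generalize s - 1 - 1 - (L : ZMod 3) = e
    ext1 a b; revert s a
    refine zz _ ?_ ?_ ?_ <;> refine zz _ ?_ ?_ ?_ <;>
    simp [sigF, Matrix.single_apply, Matrix.mul_apply, sumZ, e11, e21, e01, e2m, d01, d02, d12, d01.symm, d02.symm, d12.symm, em1, pow_succ']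

lemma detZ {R : Type*} [CommRing R] (M : Matrix (ZMod 3) (ZMod 3) R) : M.det =
    M 0 0 * M 1 1 * M 2 2 - M 0 0 * M 1 2 * M 2 1
      - M 0 1 * M 1 0 * M 2 2 + M 0 1 * M 1 2 * M 2 0
      + M 0 2 * M 1 0 * M 2 1 - M 0 2 * M 1 1 * M 2 0 :=
  Matrix.det_fin_three (R := R) M

lemma det_QA : (QA K).det ≠ 0 := by
  intro h
  have := congrArg (Polynomial.eval 0) h
  rw [detZ] at this
  simp [QA, e01, e2m, d01, d02, d12, d01.symm, d02.symm, d12.symm, em1] at this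

lemma det_QD : (QD K).det ≠ 0 := by
  intro h
  have := congrArg (Polynomial.eval 0) h
  rw [detZ] at this
  simp [QD, e01, e2m, d01, d02, d12, d01.symm, d02.symm, d12.symm, em1] at this

variable {K}

lemma mat_aux {F Q : Matrix (ZMod 3) (ZMod 3) K[X]} (hQ : Q.det ≠ 0) (n : ZMod 3 → ZMod 3 → ℕ)
    (h : ∀ s e, (F * Q) * (Matrix.single s e (X ^ n s e) * Q) * (F * Q) = 0) : F = 0 := by
  have canR : ∀ M : Matrix (ZMod 3) (ZMod 3) K[X], M * Q = 0 → M = 0 := by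
    intro M hM
    have := congrArg (· * Q.adjugate) hM
    simpa [mul_assoc, Matrix.mul_adjugate, hQ] using this
  have canL : ∀ M : Matrix (ZMod 3) (ZMod 3) K[X], Q * M = 0 → M = 0 := by
    intro M hM
    have := congrArg (Q.adjugate * ·) hM
    simpa [← mul_assoc, Matrix.adjugate_mul, hQ] using this
  by_contra hF
  have h1 : F * Q ≠ 0 := fun h => hF (canR _ h)
  have h2 : Q * (F * Q) ≠ 0 := fun h => h1 (canL _ h)
  obtain ⟨i, s, his⟩ : ∃ i s, (F * Q) i s ≠ 0 := by
    by_contra hh; push Not at hh; exact h1 (Matrix.ext hh)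
  obtain ⟨e, j, hej⟩ : ∃ e j, (Q * (F * Q)) e j ≠ 0 := by
    by_contra hh; push Not at hh; exact h2 (Matrix.ext hh)
  have h3 : (F * Q) * Matrix.single s e (X ^ n s e) * (Q * (F * Q)) = 0 := by
    rw [← h s e]; simp only [mul_assoc]
  have h4 : ((F * Q) * Matrix.single s e (X ^ n s e) * (Q * (F * Q)) : Matrix (ZMod 3) (ZMod 3) K[X]) i j = 0 := by
    rw [h3]; rfl
  rw [Matrix.mul_apply, Finset.sum_eq_single e] at h4
  · rw [Matrix.mul_single_apply_same] at h4
    exact mul_ne_zero (mul_ne_zero his (pow_ne_zero _ X_ne_zero)) hej h4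
  · intro b _ hb
    rw [Matrix.mul_single_apply_of_ne (hbj := hb), zero_mul]
  · simp

/-- coefficient extraction -/
lemma coeff_aux (t : ZMod 3 → ℕ → ZMod 3) (k : ℕ) (c : ZMod 3 × ℕ →₀ K)
    (h : c.sum (fun p a => a • Matrix.single p.1 (t p.1 p.2) ((X : K[X]) ^ (p.2 + k))) = 0) :
    c = 0 := by
  ext ⟨s, L⟩
  have := congrArg (fun M : Matrix (ZMod 3) (ZMod 3) K[X] => (M s (t s L)).coeff (L + k)) h
  simp only [Finsupp.sum, Matrix.sum_apply, Polynomial.finsetSum_coeff] at this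
  rw [Finset.sum_eq_single (s, L)] at this
  · simpa using this
  · rintro ⟨s', L'⟩ _ hne
    simp only [Matrix.smul_apply, Matrix.single_apply, Polynomial.coeff_smul]
    split_ifs with hc
    · rw [Polynomial.coeff_X_pow, if_neg, smul_zero]
      intro hL
      apply hne
      ext1
      · exact hc.1
      · simp; omega
    · simp
  · intro hn
    simp [Finsupp.notMem_support_iff.1 hn]

lemma main_aux (r : Cn 3 →* Matrix (ZMod 3) (ZMod 3) K[X]) (w : ℕ → ZMod 3 → Cn 3)
    (t : ZMod 3 → ℕ → ZMod 3) (ht : ∀ s e, ∃ L, t s L = e) (k : ℕ)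
    {Q : Matrix (ZMod 3) (ZMod 3) K[X]} (hQ : Q.det ≠ 0)
    (hr : ∀ L s, r (w L s) = Matrix.single s (t s L) (X ^ (L + k)) * Q)
    (α : MonoidAlgebra K (Cn 3)) (h : ∀ β, α * β * α = 0) (c : ZMod 3 × ℕ →₀ K)
    (hc : MonoidAlgebra.lift K _ (Cn 3) r α = c.sum fun p a => a • r (w p.2 p.1)) : c = 0 := by
  apply coeff_aux t k
  choose n hn using ht
  apply mat_aux hQ (fun s e => n s e + k)
  intro s e
  have := congrArg (MonoidAlgebra.lift K _ (Cn 3) r) (h (MonoidAlgebra.of K _ (w (n s e) s)))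
  rw [map_mul, map_mul, MonoidAlgebra.lift_of, map_zero, hr, hn, hc] at this
  have e1 : (c.sum fun p a => a • r (w p.2 p.1)) =
    c.sum (fun p a => a • Matrix.single p.1 (t p.1 p.2) ((X : K[X]) ^ (p.2 + k))) * Q := by
    simp only [Finsupp.sum, Finset.sum_mul, hr, smul_mul_assoc]
  rwa [e1] at this

lemma lift_map {B : Type*} [Ring B] [Algebra K B] (r : Cn 3 →* B)
    (a : (Unit ⊕ ZMod 3) ⊕ ((ZMod 3 × ℕ) ⊕ (ZMod 3 × ℕ)) →₀ K) :
    MonoidAlgebra.lift K B (Cn 3) r (a.sum fun n x => MonoidAlgebra.single (nf n) x) =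
      a.sum fun n x => x • r (nf n) := by
  simp [Finsupp.sum, map_sum, MonoidAlgebra.lift_single]

lemma exists_rep (α : MonoidAlgebra K (Cn 3)) :
    ∃ a : (Unit ⊕ ZMod 3) ⊕ ((ZMod 3 × ℕ) ⊕ (ZMod 3 × ℕ)) →₀ K,
      α = a.sum fun n x => MonoidAlgebra.single (nf n) x := by
  classical
  induction α using MonoidAlgebra.induction_linear with
  | zero => exact ⟨0, by simp⟩
  | add f g hf hg =>
    obtain ⟨a, rfl⟩ := hf
    obtain ⟨b, rfl⟩ := hg
    refine ⟨a + b, ?_⟩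
    rw [Finsupp.sum_add_index'] <;> simp [MonoidAlgebra.single_add]
  | single m x =>
    obtain ⟨n, rfl⟩ := nf_surj m
    exact ⟨Finsupp.single n x, by simp⟩

end

/-- Theorem 4.6 (semiprimeC3): `K[C_3]` is semiprime. -/
theorem stmt16 (K : Type*) [Field K] (α : MonoidAlgebra K (Cn 3))
    (h : ∀ β : MonoidAlgebra K (Cn 3), α * β * α = 0) : α = 0 := by
  classical
  obtain ⟨a, ha⟩ := exists_rep α
  have hsq : ∀ f : Cn 3 →* K, (a.sum fun n x => x • f (nf n)) = 0 := by
    intro f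
    have := congrArg (MonoidAlgebra.lift K K (Cn 3) f) (h 1)
    rw [mul_one, map_mul, map_zero, ha, lift_map] at this
    exact mul_self_eq_zero.1 this
  have h1 : ∀ u, a (.inl (.inl u)) = 0 := by
    intro u
    have := hsq (chi0 K)
    rw [Finsupp.sum, Finset.sum_eq_single (.inl (.inl u))] at this
    · simpa [nf] using this
    · rintro ((_ | s) | (⟨s, L⟩ | ⟨s, L⟩)) _ hne
      · exact absurd rfl hne
      · simp [nf, chi0_g]
      · simp [nf, chi0_D]
      · simp [nf, chi0_A]
    · intro hn
      simp [Finsupp.notMem_support_iff.1 hn]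
  have h2 : ∀ i, a (.inl (.inr i)) = 0 := by
    intro i
    have := hsq (chi K i)
    rw [Finsupp.sum, Finset.sum_eq_single (.inl (.inr i))] at this
    · simpa [nf, chi_g] using this
    · rintro ((_ | s) | (⟨s, L⟩ | ⟨s, L⟩)) _ hne
      · simp [h1]
      · have : i ≠ s := fun e => hne (by rw [e])
        simp [nf, chi_g, this]
      · simp [nf, chi_D]
      · simp [nf, chi_A]
    · intro hn
      simp [Finsupp.notMem_support_iff.1 hn]
  obtain ⟨⟨b, c⟩, rfl⟩ := Finsupp.sumFinsuppEquivProdFinsupp.symm.surjective a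
  obtain ⟨⟨d, e⟩, rfl⟩ := Finsupp.sumFinsuppEquivProdFinsupp.symm.surjective c
  have hb : b = 0 := by
    ext (u | i)
    · simpa using h1 u
    · simpa using h2 i
  subst hb
  have hsum : ∀ {B : Type _} [AddCommMonoid B] [Module K B] (f : _ → B),
      ((Finsupp.sumFinsuppEquivProdFinsupp.symm
        ((0 : Unit ⊕ ZMod 3 →₀ K), Finsupp.sumFinsuppEquivProdFinsupp.symm (d, e))).sum
        fun n (x : K) => x • f n) =
      (d.sum fun p x => x • f (.inr (.inl p))) + e.sum fun p x => x • f (.inr (.inr p)) := by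
    intro B _ _ f
    simp only [Finsupp.sumFinsuppEquivProdFinsupp_symm_apply]
    rw [Finsupp.sum_sumElim, Finsupp.sum_sumElim]
    simp
    rfl
  have hd : d = 0 := by
    refine main_aux (sig K) D (fun s L => s - 1 - L) ?_ 1 (det_QD K)
      (fun L s => sig_D K L s) α h d ?_
    · intro s e
      exact ⟨(s - 1 - e).val, by simp⟩
    · rw [ha, lift_map, hsum]
      simp [nf, sig_A]
  subst hd
  have he : e = 0 := by
    refine main_aux (rho K) A (fun s L => s + 1 + L) ?_ 0 (det_QA K)
      (fun L s => rho_A K L s) α h e ?_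
    · intro s e
      exact ⟨(e - s - 1).val, by simp⟩
    · rw [ha, lift_map, hsum]
      simp [nf]
  subst he
  rw [ha]
  ext
  simp [Finsupp.sum, Finsupp.sumFinsuppEquivProdFinsupp_symm_apply]

end HK
end

section
/- For every integer n ≥ 3 and every field K, the monoid algebra K[C_n] is left Noetherian and right Noetherian. -/
namespace HK

section Aux

variable {A : Type*} [Ring A]

/-- Descending product `f (a+k-1) ⋯ f a`. -/
def dsc (f : ℕ → A) (a : ℕ) : ℕ → A
  | 0 => 1
  | k + 1 => f (a + k) * dsc f a k

/-- The relations, for a periodic family. -/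
structure Sys (n : ℕ) (X : ℕ → A) : Prop where
  hn : 3 ≤ n
  per : ∀ i, X (i + n) = X i
  idem : ∀ i, X i * X i = X i
  comm : ∀ i j, i + 2 ≤ j → j + 2 ≤ i + n → X i * X j = X j * X i
  br1 : ∀ i, X i * X (i + 1) * X i = X i * X (i + 1)
  br2 : ∀ i, X (i + 1) * X i * X (i + 1) = X i * X (i + 1)

theorem dsc_succ (f : ℕ → A) (a k : ℕ) : dsc f a (k + 1) = f (a + k) * dsc f a k := rfl

theorem dsc_zero (f : ℕ → A) (a : ℕ) : dsc f a 0 = 1 := rfl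

theorem dsc_add (f : ℕ → A) (a j k : ℕ) :
    dsc f a (j + k) = dsc f (a + j) k * dsc f a j := by
  induction k with
  | zero => simp [dsc_zero]
  | succ k ih => rw [← add_assoc, dsc_succ, ih, dsc_succ, mul_assoc, add_assoc]

theorem dsc_one (f : ℕ → A) (a : ℕ) : dsc f a 1 = f a := by simp [dsc]

theorem dsc_bot (f : ℕ → A) (a k : ℕ) : dsc f a (k + 1) = dsc f (a + 1) k * f a := by
  rw [add_comm, dsc_add, dsc_one]

theorem dsc_comm (f : ℕ → A) (y : A) (a k : ℕ)
    (h : ∀ j, a ≤ j → j < a + k → Commute y (f j)) : Commute y (dsc f a k) := by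
  induction k with
  | zero => exact Commute.one_right y
  | succ k ih =>
    exact (h _ (by omega) (by omega)).mul_right (ih fun j h1 h2 => h j h1 (by omega))

namespace Sys

variable {n : ℕ} {X : ℕ → A} (S : Sys n X)
include S

theorem cm {i j : ℕ} (h : (i + 2 ≤ j ∧ j + 2 ≤ i + n) ∨ (j + 2 ≤ i ∧ i + 2 ≤ j + n)) :
    Commute (X i) (X j) := by
  rcases h with h | h
  · exact S.comm i j h.1 h.2
  · exact (S.comm j i h.1 h.2).symm

theorem dsc_per (a k : ℕ) : dsc X (a + n) k = dsc X a k := by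
  induction k with
  | zero => rfl
  | succ k ih => rw [dsc_succ, dsc_succ, ih, add_right_comm, S.per]

theorem top (a k : ℕ) : X (a + k) * dsc X a (k + 1) = dsc X a (k + 1) := by
  rw [dsc_succ, ← mul_assoc, S.idem]

theorem slide (a p q : ℕ) (h : p + 2 + q + 1 ≤ n) :
    X (a + p) * dsc X a (p + 2 + q) = dsc X a (p + 2 + q) * X (a + p + 1) := by
  have e : dsc X a (p + 2 + q)
      = dsc X (a + (p + 2)) q * (X (a + p + 1) * (X (a + p) * dsc X a p)) := by
    rw [dsc_add]; rfl
  have c1 : Commute (X (a + p)) (dsc X (a + (p + 2)) q) :=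
    dsc_comm _ _ _ _ fun j h1 h2 => S.cm (by omega)
  have c2 : Commute (X (a + p + 1)) (dsc X a p) :=
    dsc_comm _ _ _ _ fun j h1 h2 => S.cm (by omega)
  rw [e]
  calc _ = (X (a + p) * dsc X (a + (p + 2)) q) * (X (a + p + 1) * (X (a + p) * dsc X a p)) := by
        noncomm_ring
    _ = dsc X (a + (p + 2)) q * (X (a + p) * X (a + p + 1) * X (a + p)) * dsc X a p := by
        rw [c1.eq]; noncomm_ring
    _ = dsc X (a + (p + 2)) q * (X (a + p + 1) * X (a + p) * X (a + p + 1)) * dsc X a p := by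
        rw [S.br1, S.br2]
    _ = dsc X (a + (p + 2)) q * X (a + p + 1) * X (a + p) * (X (a + p + 1) * dsc X a p) := by
        noncomm_ring
    _ = _ := by rw [c2.eq]; noncomm_ring

/-- Joining two commuting runs. -/
theorem join (a p q : ℕ) (h : p + 2 + q + 1 ≤ n) :
    X (a + p) * (dsc X a p * dsc X (a + p + 1) (q + 1))
      = dsc X a (p + 2 + q) * X (a + p + 1) := by
  rw [← S.slide a p q h]
  have e : dsc X a (p + 2 + q)
      = dsc X (a + (p + 2)) q * (X (a + p + 1) * (X (a + p) * dsc X a p)) := by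
    rw [dsc_add]; rfl
  have c1 : Commute (X (a + p)) (dsc X (a + (p + 2)) q) :=
    dsc_comm _ _ _ _ fun j h1 h2 => S.cm (by omega)
  have c3 : Commute (dsc X a p) (dsc X (a + p + 1) (q + 1)) :=
    dsc_comm _ _ _ _ fun j h1 h2 =>
      (dsc_comm _ _ _ _ fun i h3 h4 => S.cm (by omega)).symm
  rw [c3.eq, dsc_bot, e]
  symm
  calc _ = (X (a + p) * dsc X (a + (p + 2)) q) * (X (a + p + 1) * (X (a + p) * dsc X a p)) := by
        noncomm_ring
    _ = dsc X (a + (p + 2)) q * (X (a + p) * X (a + p + 1) * X (a + p)) * dsc X a p := by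
        rw [c1.eq]; noncomm_ring
    _ = (dsc X (a + (p + 2)) q * X (a + p)) * X (a + p + 1) * dsc X a p := by
        rw [S.br1]; noncomm_ring
    _ = _ := by rw [← c1.eq]; simp only [mul_assoc]; rfl

end Sys

/-- the factors `1 - X`. -/
def Y (X : ℕ → A) : ℕ → A := fun j => 1 - X j

def PP (n : ℕ) (X : ℕ → A) (r : ℕ) : A := dsc (Y X) (r + 1) (n - 1 - r)

def yy (n : ℕ) (X : ℕ → A) (m : ℕ) : A :=
  ∑ r ∈ Finset.range m, (-1 : A) ^ r * (dsc X 0 r * PP n X r)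

def zz_s17 (n : ℕ) (X : ℕ → A) : A := (-1) ^ (n - 1) * yy n X n

namespace Sys

variable {n : ℕ} {X : ℕ → A} (S : Sys n X)
include S

theorem cmY {i j : ℕ} (h : (i + 2 ≤ j ∧ j + 2 ≤ i + n) ∨ (j + 2 ≤ i ∧ i + 2 ≤ j + n)) :
    Commute (X i) (Y X j) := (Commute.one_right _).sub_right (S.cm h)

theorem PP_zero (r c : ℕ) (h : r < c) (hc : c < n) : PP n X r * X c = 0 := by
  obtain ⟨t, rfl⟩ : ∃ t, c = r + 1 + t := ⟨c - r - 1, by omega⟩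
  obtain ⟨q, rfl⟩ : ∃ q, n = r + 2 + t + q := ⟨n - (r + 2 + t), by omega⟩
  have e : PP (r + 2 + t + q) X r
      = dsc (Y X) (r + 1 + (t + 1)) q * (Y X (r + 1 + t) * dsc (Y X) (r + 1) t) := by
    rw [PP, ← dsc_succ, ← dsc_add]; congr 1; omega
  rw [e, mul_assoc]
  suffices Y X (r + 1 + t) * dsc (Y X) (r + 1) t * X (r + 1 + t) = 0 by rw [this, mul_zero]
  rcases t with _ | t
  · simp [dsc, Y, sub_mul, S.idem]
  · have c1 : Commute (X (r + 1 + (t + 1))) (dsc (Y X) (r + 1) t) :=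
      dsc_comm _ _ _ _ fun j h1 h2 => S.cmY (by omega)
    rw [dsc_succ, mul_assoc, mul_assoc, ← c1.eq, ← mul_assoc, ← mul_assoc]
    have := S.br2 (r + 1 + t)
    have h2 := S.idem (r + 1 + t + 1)
    have : Y X (r + 1 + (t + 1)) * Y X (r + 1 + t) * X (r + 1 + (t + 1)) = 0 := by
      simp only [Y, ← add_assoc] at *
      calc _ = X (r + 1 + t + 1) - X (r + 1 + t) * X (r + 1 + t + 1)
            - X (r + 1 + t + 1) * X (r + 1 + t + 1)
            + X (r + 1 + t + 1) * X (r + 1 + t) * X (r + 1 + t + 1) := by noncomm_ring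
        _ = 0 := by rw [this, h2]; noncomm_ring
    rw [this, zero_mul]

theorem PP_step (r : ℕ) (h : r + 1 < n) : PP n X r = PP n X (r + 1) * Y X (r + 1) := by
  obtain ⟨q, rfl⟩ : ∃ q, n = r + 2 + q := ⟨n - (r + 2), by omega⟩
  rw [PP, PP, ← dsc_bot]; congr 1; omega

theorem absorb (c r : ℕ) (h : c < r) (hr : r < n) :
    X c * (dsc X 0 c * (PP n X r * X c)) = dsc X 0 c * (PP n X r * X c) := by
  rcases c with _ | c
  · rw [dsc_zero, one_mul]
    obtain ⟨q, rfl⟩ : ∃ q, n = r + 1 + q := ⟨n - (r + 1), by omega⟩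
    have e : PP (r + 1 + q) X r = dsc (Y X) (r + 1) q := by rw [PP]; congr 1; omega
    rw [e]
    rcases q with _ | q
    · simp [dsc, S.idem]
    · have c1 : Commute (X 0) (dsc (Y X) (r + 1) q) :=
        dsc_comm _ _ _ _ fun j h1 h2 => S.cmY (by omega)
      have h0 : X (r + 1 + q + 1) = X 0 := by
        have := S.per 0; rw [← this]; congr 1; omega
      have b := S.br2 (r + 1 + q)
      rw [h0] at b
      rw [dsc_succ, mul_assoc, ← c1.eq, ← mul_assoc, ← mul_assoc, ← mul_assoc]
      congr 1
      simp only [Y]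
      calc _ = X 0 * X 0 - X 0 * X (r + 1 + q) * X 0 := by noncomm_ring
        _ = _ := by rw [b, S.idem]; noncomm_ring
  · have c1 : Commute (X (c + 1)) (PP n X r) :=
      dsc_comm _ _ _ _ fun j h1 h2 => S.cmY (by omega)
    have c2 : Commute (X (c + 1)) (dsc X 0 c) :=
      dsc_comm _ _ _ _ fun j h1 h2 => S.cm (by omega)
    rw [← c1.eq, dsc_succ, zero_add]
    calc _ = X (c + 1) * X c * (dsc X 0 c * X (c + 1)) * PP n X r := by noncomm_ring
      _ = (X (c + 1) * X c * X (c + 1)) * dsc X 0 c * PP n X r := by rw [← c2.eq]; noncomm_ring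
      _ = X c * (X (c + 1) * dsc X 0 c) * PP n X r := by rw [S.br2]; noncomm_ring
      _ = _ := by rw [c2.eq]; noncomm_ring

theorem tele (c m : ℕ) (h : c + 1 + m ≤ n) :
    yy n X (c + 1 + m) * X c
      = (-1) ^ (c + m) * (dsc X 0 c * (PP n X (c + m) * (dsc X (c + 1) m * X c))) := by
  induction m with
  | zero =>
    rw [add_zero, yy, Finset.sum_range_succ, add_mul, Finset.sum_mul, Finset.sum_eq_zero, zero_add]
    · simp [dsc_zero, mul_assoc]
    · intro r hr
      rw [mul_assoc, mul_assoc, S.PP_zero r c (by simpa using hr) (by omega), mul_zero, mul_zero]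
  | succ m ih =>
    have e1 : yy n X (c + 1 + (m + 1)) = yy n X (c + 1 + m)
        + (-1 : A) ^ (c + 1 + m) * (dsc X 0 (c + 1 + m) * PP n X (c + 1 + m)) := by
      rw [yy, ← add_assoc, Finset.sum_range_succ]; rfl
    rw [e1, add_mul, ih (by omega), S.PP_step (c + m) (by omega)]
    have c1 : Commute (PP n X (c + m + 1)) (dsc X (c + 1) m) :=
      dsc_comm _ _ _ _ fun j h1 h2 =>
        (dsc_comm _ _ _ _ fun i h3 h4 => S.cmY (by omega)).symm
    have c3 : Commute (dsc X (c + 1) m) (dsc X 0 c) :=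
      dsc_comm _ _ _ _ fun j h1 h2 =>
        (dsc_comm _ _ _ _ fun i h3 h4 => S.cm (by omega)).symm
    have e2 : dsc X 0 (c + 1 + m) = dsc X (c + 1) m * (X c * dsc X 0 c) := by
      rw [dsc_add, dsc_succ]; simp
    have e3 := S.absorb c (c + 1 + m) (by omega) (by omega)
    have e4 : dsc X 0 (c + 1 + m) * PP n X (c + 1 + m) * X c
        = dsc X 0 c * (PP n X (c + m + 1) * (dsc X (c + 1) m * X c)) := by
      rw [e2]
      calc _ = dsc X (c + 1) m * (X c * (dsc X 0 c * (PP n X (c + 1 + m) * X c))) := by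
            noncomm_ring
        _ = (dsc X (c + 1) m * dsc X 0 c) * (PP n X (c + m + 1) * X c) := by
            rw [e3, add_right_comm c 1 m, mul_assoc]
        _ = dsc X 0 c * (dsc X (c + 1) m * PP n X (c + m + 1)) * X c := by
            rw [c3.eq]; noncomm_ring
        _ = _ := by rw [← c1.eq]; noncomm_ring
    rw [mul_assoc ((-1 : A) ^ (c + 1 + m)), e4, dsc_succ X (c + 1) m, add_right_comm c 1 m,
      ← add_assoc, pow_succ]
    simp only [Y]
    noncomm_ring

theorem zz_lt (c : ℕ) (hc : c < n) : zz_s17 n X * X c = dsc X c n := by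
  obtain ⟨q, rfl⟩ : ∃ q, n = c + 1 + q := ⟨n - (c + 1), by omega⟩
  have e : PP (c + 1 + q) X (c + q) = 1 := by
    have : c + 1 + q - 1 - (c + q) = 0 := by omega
    rw [PP, this, dsc_zero]
  rw [zz_s17, mul_assoc, S.tele c q le_rfl, e, one_mul, ← mul_assoc, ← pow_add]
  have : c + 1 + q - 1 + (c + q) = 2 * (c + q) := by omega
  rw [this, pow_mul, neg_one_sq, one_pow, one_mul, ← dsc_bot, ← S.dsc_per 0 c]
  have e5 : c + 1 + q = (q + 1) + c := by omega
  rw [e5, dsc_add X c (q + 1) c]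
  congr 2; omega

theorem zz_mul (c : ℕ) : zz_s17 n X * X c = dsc X c n := by
  have key : ∀ k c, c < n → zz_s17 n X * X (c + k * n) = dsc X (c + k * n) n := by
    intro k
    induction k with
    | zero => intro c hc; simpa using S.zz_lt c hc
    | succ k ih =>
      intro c hc
      have : c + (k + 1) * n = c + k * n + n := by ring
      rw [this, S.per, S.dsc_per, ih c hc]
  have h := key (c / n) (c % n) (Nat.mod_lt _ (by have := S.hn; omega))
  rwa [Nat.mod_add_div' c n] at h

theorem modeq {i j : ℕ} (h : i ≡ j [MOD n]) : X i = X j := by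
  have key : ∀ k c, X (c + k * n) = X c := by
    intro k
    induction k with
    | zero => intro c; simp
    | succ k ih => intro c; rw [show c + (k + 1) * n = c + k * n + n by ring, S.per, ih]
  have h1 := key (i / n) (i % n)
  have h2 := key (j / n) (j % n)
  rw [Nat.mod_add_div'] at h1 h2
  rw [h1, h2, h]

theorem rep (i c : ℕ) : ∃ t < n, i ≡ c + t [MOD n] := by
  have hn := S.hn
  refine ⟨(i + (n - c % n)) % n, Nat.mod_lt _ (by omega), ?_⟩
  have h1 := Nat.mod_lt c (show 0 < n by omega)
  have h2 : c + (i + (n - c % n)) = i + n * (c / n + 1) := by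
    have := Nat.mod_add_div c n
    rw [mul_add]; omega
  have : c + (i + (n - c % n)) % n ≡ c + (i + (n - c % n)) [MOD n] :=
    Nat.ModEq.add_left _ (Nat.mod_modEq _ _)
  refine (this.trans ?_).symm
  rw [h2]
  simp [Nat.ModEq]

/-- the shift relation. -/
theorem shift (i c : ℕ) : X i * (zz_s17 n X * X c) = zz_s17 n X * (X (i + 1) * X c) := by
  have hn := S.hn
  obtain ⟨t, ht, hi⟩ := S.rep i c
  rw [S.modeq hi, S.modeq (hi.add_right 1), S.zz_mul, ← mul_assoc, S.zz_mul]
  obtain ⟨m, rfl⟩ : ∃ m, n = m + 1 := ⟨n - 1, by omega⟩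
  by_cases h1 : t = m
  · subst h1
    rw [S.top, add_assoc, S.dsc_per, dsc_bot, mul_assoc, S.idem]
  by_cases h2 : t = 0
  · subst h2
    simp only [add_zero]
    rw [dsc_bot, dsc_succ X (c + 1) m, add_assoc, add_comm 1 m, S.per, mul_assoc]
  · have hx : X c * X (c + t + 1) * X c = X (c + t + 1) * X c := by
      by_cases h3 : t + 1 = m
      · have b := S.br2 (c + t + 1)
        have : c + t + 1 + 1 = c + (m + 1) := by omega
        rwa [this, S.per] at b
      · have b : Commute (X c) (X (c + t + 1)) := S.cm (by omega)
        rw [b.eq, mul_assoc, S.idem]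
    obtain ⟨q, hq⟩ : ∃ q, m = (t - 1) + 2 + q := ⟨m - (t - 1 + 2), by omega⟩
    have sl := S.slide (c + 1) (t - 1) q (by omega)
    rw [← hq] at sl
    have e1 : c + 1 + (t - 1) = c + t := by omega
    rw [e1] at sl
    rw [← S.zz_mul (c + t + 1), mul_assoc, ← hx, ← mul_assoc, ← mul_assoc, S.zz_mul, dsc_bot,
      ← mul_assoc, sl]
    simp only [mul_assoc] at hx ⊢
    rw [hx]

end Sys

/-- Evaluation of a word. -/
def Wd (X : ℕ → A) (l : List ℕ) : A := (l.map X).prod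

theorem Wd_nil (X : ℕ → A) : Wd X [] = 1 := rfl

theorem Wd_cons (X : ℕ → A) (i : ℕ) (l : List ℕ) : Wd X (i :: l) = X i * Wd X l := by
  simp [Wd]

theorem Wd_append (X : ℕ → A) (l m : List ℕ) : Wd X (l ++ m) = Wd X l * Wd X m := by
  simp [Wd]

theorem Wd_comm (X : ℕ → A) (y : A) (l : List ℕ) (h : ∀ j ∈ l, Commute y (X j)) :
    Commute y (Wd X l) := by
  induction l with
  | nil => exact Commute.one_right y
  | cons i l ih =>
    rw [Wd_cons]
    exact (h i (by simp)).mul_right (ih fun j hj => h j (by simp [hj]))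

namespace Sys

variable {n : ℕ} {X : ℕ → A} (S : Sys n X)
include S

theorem split (a k j : ℕ) (hk : k + 1 ≤ n) (v : List ℕ) (hv : ∀ i ∈ v, a ≤ i ∧ i < a + k)
    (hj : a ≤ j ∧ j < a + k) (hjv : j ∉ v) :
    Wd X v = Wd X (v.filter (· < j)) * Wd X (v.filter (j < ·)) ∧
    v.length = (v.filter (· < j)).length + (v.filter (j < ·)).length := by
  induction v with
  | nil => simp [Wd]
  | cons i v ih =>
    obtain ⟨h1, h2⟩ := ih (fun x hx => hv x (by simp [hx])) (fun h => hjv (by simp [h]))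
    have hi := hv i (by simp)
    have hij : i ≠ j := fun h => hjv (by simp [h])
    rw [Wd_cons, h1]
    by_cases h : i < j
    · have h' : ¬ j < i := by omega
      simp only [List.filter_cons, h, h', decide_true, decide_false, if_true,
        Bool.false_eq_true, if_false, Wd_cons, mul_assoc, List.length_cons, true_and]
      omega
    · have h' : j < i := by omega
      have c1 : Commute (X i) (Wd X (v.filter (· < j))) := by
        apply Wd_comm
        intro x hx
        rw [List.mem_filter] at hx
        have hx2 := of_decide_eq_true hx.2
        have := hv x (by simp [hx.1])
        exact S.cm (by omega)
      simp only [List.filter_cons, h, h', decide_true, decide_false, if_true,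
        Bool.false_eq_true, if_false, Wd_cons, List.length_cons]
      refine ⟨?_, by omega⟩
      rw [← mul_assoc, ← mul_assoc, c1.eq]

theorem line (N : ℕ) : ∀ (v : List ℕ), v.length ≤ N → ∀ a k, k + 1 ≤ n →
    (∀ j ∈ v, a ≤ j ∧ j < a + k) → (∀ j, a ≤ j → j < a + k → j ∈ v) →
    ∃ h : List ℕ, Wd X v = dsc X a k * Wd X h ∧ h.length ≤ v.length - 1 ∧
      ∀ j ∈ h, a ≤ j ∧ j < a + k := by
  induction N with
  | zero =>
    intro v hv a k hk h1 h2
    have : v = [] := List.length_eq_zero_iff.mp (by omega)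
    subst this
    have : k = 0 := by
      by_contra h
      have := h2 a le_rfl (by omega)
      simp at this
    subst this
    exact ⟨[], by simp [dsc_zero], by simp, by simp⟩
  | succ N ih =>
    intro v hv a k hk h1 h2
    rcases v with _ | ⟨j, v⟩
    · exact ih [] (by simp) a k hk h1 h2
    simp only [List.length_cons] at hv
    have hj := h1 j (by simp)
    have h1' : ∀ i ∈ v, a ≤ i ∧ i < a + k := fun i hi => h1 i (by simp [hi])
    obtain ⟨p, rfl⟩ : ∃ p, j = a + p := ⟨j - a, by omega⟩
    by_cases hjv : a + p ∈ v
    · obtain ⟨h, e, hl, hm⟩ := ih v (by omega) a k hk h1' (fun i hi hi' => by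
        have := h2 i hi hi'
        rw [List.mem_cons] at this
        rcases this with rfl | this
        · exact hjv
        · exact this)
      have hvl : 0 < v.length := List.length_pos_of_mem hjv
      by_cases hp : p + 1 = k
      · subst hp
        refine ⟨h, ?_, by simp only [List.length_cons]; omega, hm⟩
        rw [Wd_cons, e, ← mul_assoc, S.top]
      · obtain ⟨q, rfl⟩ : ∃ q, k = p + 2 + q := ⟨k - (p + 2), by omega⟩
        refine ⟨(a + p + 1) :: h, ?_, by simp only [List.length_cons]; omega, ?_⟩
        · rw [Wd_cons, e, ← mul_assoc, S.slide a p q hk, Wd_cons, mul_assoc]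
        · intro i hi
          rw [List.mem_cons] at hi
          rcases hi with rfl | hi
          · omega
          · exact hm i hi
    · obtain ⟨e, el⟩ := S.split a k (a + p) hk v h1' hj hjv
      obtain ⟨g1, e1, l1, m1⟩ := ih (v.filter (· < a + p)) (by omega) a p (by omega)
        (fun i hi => by
          rw [List.mem_filter] at hi
          have := of_decide_eq_true hi.2
          have := h1' i hi.1
          omega)
        (fun i hi hi' => by
          have := h2 i hi (by omega)
          rw [List.mem_cons] at this
          rcases this with rfl | this
          · omega
          · exact List.mem_filter.mpr ⟨this, decide_eq_true hi'⟩)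
      by_cases hp : p + 1 = k
      · subst hp
        have hnil : v.filter (a + p < ·) = [] := by
          rw [List.filter_eq_nil_iff]
          intro i hi
          have := h1' i hi
          simp only [decide_eq_true_eq]
          omega
        refine ⟨g1, ?_, by simp only [List.length_cons]; omega,
          fun i hi => by have := m1 i hi; omega⟩
        rw [Wd_cons, e, hnil, Wd_nil, mul_one, e1, dsc_succ, mul_assoc]
      · obtain ⟨q, rfl⟩ : ∃ q, k = p + 2 + q := ⟨k - (p + 2), by omega⟩
        obtain ⟨g2, e2, l2, m2⟩ := ih (v.filter (a + p < ·)) (by omega) (a + p + 1) (q + 1)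
          (by omega)
          (fun i hi => by
            rw [List.mem_filter] at hi
            have := of_decide_eq_true hi.2
            have := h1' i hi.1
            omega)
          (fun i hi hi' => by
            have := h2 i (by omega) (by omega)
            rw [List.mem_cons] at this
            rcases this with rfl | this
            · omega
            · exact List.mem_filter.mpr ⟨this, decide_eq_true (by omega)⟩)
        have hne : 0 < (v.filter (a + p < ·)).length := by
          have := h2 (a + p + 1) (by omega) (by omega)
          rw [List.mem_cons] at this
          rcases this with h | this
          · omega
          · exact List.length_pos_of_mem (a := a + p + 1)
              (List.mem_filter.mpr ⟨this, decide_eq_true (by omega)⟩)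
        refine ⟨(a + p + 1) :: (g1 ++ g2), ?_, ?_, ?_⟩
        · have c1 : Commute (dsc X (a + p + 1) (q + 1)) (Wd X g1) :=
            Wd_comm _ _ _ fun i hi =>
              (dsc_comm _ _ _ _ fun j h3 h4 => S.cm (by have := m1 i hi; omega)).symm
          rw [Wd_cons, e, e1, e2, Wd_cons, Wd_append, ← mul_assoc (dsc X a (p + 2 + q)),
            ← S.join a p q hk]
          simp only [mul_assoc]
          rw [← mul_assoc (Wd X g1), ← c1.eq, mul_assoc]
        · simp only [List.length_cons, List.length_append]; omega
        · intro i hi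
          rw [List.mem_cons, List.mem_append] at hi
          rcases hi with rfl | hi | hi
          · omega
          · have := m1 i hi; omega
          · have := m2 i hi; omega

theorem conv (i : ℕ) (w : List ℕ) (hw : ∀ j ∈ w, ¬ j ≡ i [MOD n]) :
    ∃ v : List ℕ, Wd X v = Wd X w ∧ v.length = w.length ∧
      (∀ j ∈ v, i + 1 ≤ j ∧ j < i + 1 + (n - 1)) ∧ ∀ j ∈ w, ∃ j' ∈ v, j ≡ j' [MOD n] := by
  induction w with
  | nil => exact ⟨[], rfl, rfl, by simp, by simp⟩
  | cons j w ih =>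
    obtain ⟨v, e, l, m, f⟩ := ih fun x hx => hw x (by simp [hx])
    obtain ⟨t, ht, hj⟩ := S.rep j i
    have ht0 : t ≠ 0 := by
      rintro rfl
      exact hw j (by simp) hj
    refine ⟨(i + t) :: v, ?_, by simp [l], ?_, ?_⟩
    · rw [Wd_cons, Wd_cons, e, S.modeq hj]
    · intro x hx
      rw [List.mem_cons] at hx
      rcases hx with rfl | hx
      · omega
      · exact m x hx
    · intro x hx
      rw [List.mem_cons] at hx
      rcases hx with rfl | hx
      · exact ⟨i + t, by simp, hj⟩
      · obtain ⟨y, hy, hxy⟩ := f x hx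
        exact ⟨y, by simp [hy], hxy⟩

theorem full (w : List ℕ) (hw : ∀ i, ∃ j ∈ w, j ≡ i [MOD n]) :
    ∃ h : List ℕ, h ≠ [] ∧ Wd X w = zz_s17 n X * Wd X h ∧ h.length < w.length := by
  have hn := S.hn
  induction w with
  | nil => obtain ⟨j, hj, _⟩ := hw 0; simp at hj
  | cons i w ih =>
    by_cases hf : ∀ i, ∃ j ∈ w, j ≡ i [MOD n]
    · obtain ⟨h, h0, e, l⟩ := ih hf
      rcases h with _ | ⟨c, h⟩
      · exact absurd rfl h0
      refine ⟨(i + 1) :: c :: h, by simp, ?_, by simpa using l⟩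
      rw [Wd_cons, e, Wd_cons, Wd_cons, Wd_cons, ← mul_assoc (zz_s17 n X), ← mul_assoc (X i), S.shift]
      simp only [mul_assoc]
    · push Not at hf
      obtain ⟨i0, h0⟩ := hf
      have hi0 : i ≡ i0 [MOD n] := by
        obtain ⟨j, hj, hj2⟩ := hw i0
        rw [List.mem_cons] at hj
        rcases hj with rfl | hj
        · exact hj2
        · exact absurd hj2 (h0 j hj)
      have h1 : ∀ j ∈ w, ¬ j ≡ i [MOD n] := fun j hj h => h0 j hj (h.trans hi0)
      obtain ⟨v, e, l, m, f⟩ := S.conv i w h1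
      obtain ⟨h, e2, l2, -⟩ := S.line v.length v le_rfl (i + 1) (n - 1) (by omega) m (by
        intro j hj hj'
        obtain ⟨x, hx, hxj⟩ := hw j
        rw [List.mem_cons] at hx
        rcases hx with rfl | hx
        · exfalso
          have := (Nat.modEq_iff_dvd' (by omega)).mp hxj
          have := Nat.le_of_dvd (by omega) this
          omega
        · obtain ⟨y, hy, hxy⟩ := f x hx
          have hyj : y ≡ j [MOD n] := hxy.symm.trans hxj
          have hym := m y hy
          have : y = j := by
            rcases le_total y j with h | h
            · have := (Nat.modEq_iff_dvd' h).mp hyj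
              by_contra hne
              have := Nat.le_of_dvd (by omega) this
              omega
            · have := (Nat.modEq_iff_dvd' h).mp hyj.symm
              by_contra hne
              have := Nat.le_of_dvd (by omega) this
              omega
          exact this ▸ hy)
      have hv : 0 < v.length := by
        obtain ⟨x, hx, hxj⟩ := hw (i + 1)
        rw [List.mem_cons] at hx
        rcases hx with rfl | hx
        · exfalso
          have := (Nat.modEq_iff_dvd' (by omega)).mp hxj
          have := Nat.le_of_dvd (by omega) this
          omega
        · rw [l]; exact List.length_pos_of_mem hx
      refine ⟨(i + 1) :: h, by simp, ?_, by simp only [List.length_cons]; omega⟩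
      rw [Wd_cons, ← e, e2, Wd_cons, ← mul_assoc, ← mul_assoc, S.zz_mul]
      congr 1
      obtain ⟨m', rfl⟩ : ∃ m', n = m' + 1 := ⟨n - 1, by omega⟩
      rw [dsc_succ, show i + 1 + m' = i + (m' + 1) by ring, S.per]
      rfl

theorem fin_line (k : ℕ) : ∀ a, k + 1 ≤ n →
    {y : A | ∃ v : List ℕ, (∀ j ∈ v, a ≤ j ∧ j < a + k) ∧ Wd X v = y}.Finite := by
  induction k with
  | zero =>
    intro a _
    refine (Set.finite_singleton (1 : A)).subset ?_
    rintro y ⟨v, hv, rfl⟩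
    rcases v with _ | ⟨i, v⟩
    · exact Wd_nil X
    · have := hv i (by simp); omega
  | succ k ih =>
    intro a hk
    have hfin := ih (a + 1) (by omega)
    refine ((Set.finite_Iic (k + 1)).biUnion fun r _ => hfin.image fun y => dsc X a r * y).subset ?_
    rintro y ⟨v, hv, rfl⟩
    suffices ∃ r ≤ k + 1, ∃ h : List ℕ, (∀ j ∈ h, a + 1 ≤ j ∧ j < a + 1 + k) ∧
        Wd X v = dsc X a r * Wd X h by
      obtain ⟨r, hr, h, hh, e⟩ := this
      simp only [Set.mem_iUnion]
      exact ⟨r, hr, Wd X h, ⟨h, hh, rfl⟩, e.symm⟩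
    induction v with
    | nil => exact ⟨0, by omega, [], by simp, by simp [dsc_zero]⟩
    | cons i v ihv =>
      obtain ⟨r, hr, h, hh, e⟩ := ihv fun j hj => hv j (by simp [hj])
      have hi := hv i (by simp)
      obtain ⟨p, rfl⟩ : ∃ p, i = a + p := ⟨i - a, by omega⟩
      rw [Wd_cons, e]
      by_cases h1 : p = r
      · subst h1
        exact ⟨p + 1, by omega, h, hh, by rw [dsc_succ, mul_assoc]⟩
      by_cases h2 : p + 1 = r
      · subst h2
        exact ⟨p + 1, hr, h, hh, by rw [← mul_assoc, S.top]⟩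
      by_cases h3 : p < r
      · obtain ⟨q, rfl⟩ : ∃ q, r = p + 2 + q := ⟨r - (p + 2), by omega⟩
        refine ⟨p + 2 + q, hr, (a + p + 1) :: h, ?_, ?_⟩
        · intro x hx
          rw [List.mem_cons] at hx
          rcases hx with rfl | hx
          · omega
          · exact hh x hx
        · rw [← mul_assoc, S.slide a p q (by omega), Wd_cons, mul_assoc]
      · refine ⟨r, hr, (a + p) :: h, ?_, ?_⟩
        · intro x hx
          rw [List.mem_cons] at hx
          rcases hx with rfl | hx
          · omega
          · exact hh x hx
        · have c : Commute (X (a + p)) (dsc X a r) :=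
            dsc_comm _ _ _ _ fun j h4 h5 => S.cm (by omega)
          rw [← mul_assoc, c.eq, Wd_cons, mul_assoc]

theorem fin_nonfull :
    {y : A | ∃ v : List ℕ, (¬ ∀ i, ∃ j ∈ v, j ≡ i [MOD n]) ∧ Wd X v = y}.Finite := by
  have hn := S.hn
  refine ((Set.finite_Iio n).biUnion fun i _ => S.fin_line (n - 1) (i + 1) (by omega)).subset ?_
  rintro y ⟨w, hw, rfl⟩
  push Not at hw
  obtain ⟨i, hi⟩ := hw
  obtain ⟨v, e, l, m, f⟩ := S.conv (i % n) w
    (fun j hj h => hi j hj (h.trans (Nat.mod_modEq i n)))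
  simp only [Set.mem_iUnion]
  exact ⟨i % n, Nat.mod_lt _ (by omega), v, m, e⟩

theorem noeth {K : Type*} [Field K] [Algebra K A]
    (hsp : Submodule.span K (Set.range (Wd X)) = ⊤) : IsNoetherianRing A := by
  let φ : (Polynomial K) →ₐ[K] A := Polynomial.aeval (zz_s17 n X)
  let _ : Module (Polynomial K) A := Module.compHom A φ.toRingHom
  have smul_def : ∀ (p : (Polynomial K)) (a : A), p • a = φ p * a := fun _ _ => rfl
  have : IsScalarTower (Polynomial K) A A := ⟨fun p a b => by simp [smul_def, mul_assoc]⟩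
  have hfin := S.fin_nonfull
  set F := {y : A | ∃ v : List ℕ, (¬ ∀ i, ∃ j ∈ v, j ≡ i [MOD n]) ∧ Wd X v = y} with hF
  have key : ∀ N, ∀ w : List ℕ, w.length ≤ N → Wd X w ∈ Submodule.span (Polynomial K) F := by
    intro N
    induction N with
    | zero =>
      intro w hw
      have : w = [] := List.length_eq_zero_iff.mp (by omega)
      subst this
      exact Submodule.subset_span ⟨[], by simp, rfl⟩
    | succ N ih =>
      intro w hw
      by_cases hf : ∀ i, ∃ j ∈ w, j ≡ i [MOD n]
      · obtain ⟨h, -, e, l⟩ := S.full w hf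
        have := Submodule.smul_mem _ (Polynomial.X : Polynomial K) (ih h (by omega))
        rw [smul_def] at this
        rw [e]
        simpa [φ] using this
      · exact Submodule.subset_span ⟨w, hf, rfl⟩
  have htop : Submodule.span (Polynomial K) F = ⊤ := by
    rw [eq_top_iff]
    intro a _
    have ha : a ∈ Submodule.span K (Set.range (Wd X)) := by rw [hsp]; trivial
    induction ha using Submodule.span_induction with
    | mem x hx => obtain ⟨w, rfl⟩ := hx; exact key _ w le_rfl
    | zero => exact zero_mem _
    | add x y _ _ hx hy => exact add_mem (hx trivial) (hy trivial)
    | smul c x _ hx =>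
      have := Submodule.smul_mem _ (Polynomial.C c : Polynomial K) (hx trivial)
      rw [smul_def] at this
      simpa [φ, Algebra.smul_def] using this
  have : Module.Finite (Polynomial K) A := ⟨Submodule.fg_def.mpr ⟨F, hfin, htop⟩⟩
  have : IsNoetherian (Polynomial K) A := isNoetherian_of_isNoetherianRing_of_finite (Polynomial K) A
  exact isNoetherian_of_tower (Polynomial K) ‹_›

end Sys
end Aux

theorem gen_sys {n : ℕ} (hn : 3 ≤ n) {A : Type*} [Ring A] (x : ZMod n → A)
    (h1 : ∀ a, x a * x a = x a)
    (h2 : ∀ a b, b ≠ a + 1 → a ≠ b + 1 → x a * x b = x b * x a)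
    (h3 : ∀ a, x a * x (a + 1) * x a = x a * x (a + 1))
    (h4 : ∀ a, x (a + 1) * x a * x (a + 1) = x a * x (a + 1)) :
    Sys n (fun k : ℕ => x (k : ZMod n)) where
  hn := hn
  per i := by simp
  idem i := h1 _
  comm i j hij hji := by
    apply h2
    · intro h
      have h' : ((j : ℕ) : ZMod n) = ((i + 1 : ℕ) : ZMod n) := by push_cast; exact h
      rw [ZMod.natCast_eq_natCast_iff] at h'
      have := Nat.le_of_dvd (by omega) ((Nat.modEq_iff_dvd' (by omega)).mp h'.symm)
      omega
    · intro h
      have h' : ((i : ℕ) : ZMod n) = ((j + 1 : ℕ) : ZMod n) := by push_cast; exact h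
      rw [ZMod.natCast_eq_natCast_iff] at h'
      have h5 := Nat.le_of_dvd (by omega) ((Nat.modEq_iff_dvd' (by omega)).mp h')
      omega
  br1 i := by push_cast; exact h3 _
  br2 i := by push_cast; exact h4 _

theorem gen_noeth {n : ℕ} (hn : 3 ≤ n) (K : Type*) [Field K] {A : Type*} [Ring A] [Algebra K A]
    (x : ZMod n → A)
    (h1 : ∀ a, x a * x a = x a)
    (h2 : ∀ a b, b ≠ a + 1 → a ≠ b + 1 → x a * x b = x b * x a)
    (h3 : ∀ a, x a * x (a + 1) * x a = x a * x (a + 1))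
    (h4 : ∀ a, x (a + 1) * x a * x (a + 1) = x a * x (a + 1))
    (hsp : ∀ y : A, y ∈ Submodule.span K (Set.range fun l : List (ZMod n) => (l.map x).prod)) :
    IsNoetherianRing A := by
  have : NeZero n := ⟨by omega⟩
  refine (gen_sys hn x h1 h2 h3 h4).noeth (K := K) ?_
  rw [eq_top_iff]
  intro y _
  refine Submodule.span_mono ?_ (hsp y)
  rintro _ ⟨l, rfl⟩
  refine ⟨l.map ZMod.val, ?_⟩
  simp [Wd, List.map_map, Function.comp_def]

/-- The generators in the algebra. -/
noncomputable def gx (n : ℕ) (K : Type*) [Field K] (a : ZMod n) : MonoidAlgebra K (Cn n) :=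
  MonoidAlgebra.of K (Cn n) (pr n (FreeMonoid.of a))

theorem pr_rel (n : ℕ) {u v : FreeMonoid (ZMod n)} (h : cnRel n u v) : pr n u = pr n v :=
  (Con.eq _).mpr (ConGen.Rel.of _ _ h)

section
variable (n : ℕ) (K : Type*) [Field K]

theorem gx1 (a : ZMod n) : gx n K a * gx n K a = gx n K a := by
  simp only [gx, ← map_mul]
  exact congrArg _ (pr_rel n (Or.inl ⟨a, rfl, rfl⟩))

theorem gx2 (a b : ZMod n) (h : b ≠ a + 1) (h' : a ≠ b + 1) :
    gx n K a * gx n K b = gx n K b * gx n K a := by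
  simp only [gx, ← map_mul]
  exact congrArg _ (pr_rel n (Or.inr (Or.inl ⟨a, b, h, h', rfl, rfl⟩)))

theorem gx3 (a : ZMod n) : gx n K a * gx n K (a + 1) * gx n K a = gx n K a * gx n K (a + 1) := by
  simp only [gx, ← map_mul]
  exact congrArg _ (pr_rel n (Or.inr (Or.inr ⟨a, Or.inl rfl, rfl⟩)))

theorem gx4 (a : ZMod n) :
    gx n K (a + 1) * gx n K a * gx n K (a + 1) = gx n K a * gx n K (a + 1) := by
  simp only [gx, ← map_mul]
  exact congrArg _ (pr_rel n (Or.inr (Or.inr ⟨a, Or.inr rfl, rfl⟩)))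

theorem gx_word (w : FreeMonoid (ZMod n)) :
    MonoidAlgebra.of K (Cn n) (pr n w) = ((FreeMonoid.toList w).map (gx n K)).prod := by
  induction w using FreeMonoid.recOn with
  | one => rw [map_one, map_one]; rfl
  | of_mul a w ih => simp [gx, map_mul, ih]

theorem gx_span (y : MonoidAlgebra K (Cn n)) :
    y ∈ Submodule.span K (Set.range fun l : List (ZMod n) => (l.map (gx n K)).prod) := by
  induction y using MonoidAlgebra.induction_on with
  | of g =>
    obtain ⟨w, rfl⟩ := Con.mk'_surjective (c := conGen (cnRel n)) g
    exact Submodule.subset_span ⟨_, (gx_word n K w).symm⟩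
  | add f g hf hg => exact add_mem hf hg
  | smul r f hf => exact Submodule.smul_mem _ r hf

end

open MulOpposite in
theorem op_noeth (n : ℕ) (hn : 3 ≤ n) (K : Type*) [Field K] :
    IsNoetherianRing (MonoidAlgebra K (Cn n))ᵐᵒᵖ := by
  refine gen_noeth hn K (fun a => op (gx n K (-a))) ?_ ?_ ?_ ?_ ?_
  · intro a; rw [← op_mul, gx1]
  · intro a b h h'
    rw [← op_mul, ← op_mul, gx2]
    · intro e; apply h; linear_combination e
    · intro e; apply h'; linear_combination e
  · intro a
    have h := gx4 n K (-(a + 1))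
    rw [show -(a + 1) + 1 = -a by ring] at h
    rw [← op_mul, ← op_mul, ← mul_assoc, h]
  · intro a
    have h := gx3 n K (-(a + 1))
    rw [show -(a + 1) + 1 = -a by ring] at h
    rw [← op_mul, ← op_mul, ← op_mul, ← mul_assoc, h]
  · intro y
    have hy := gx_span n K (unop y)
    rw [← op_unop y]
    generalize unop y = t at hy ⊢
    induction hy using Submodule.span_induction with
    | mem x hx =>
      obtain ⟨l, rfl⟩ := hx
      refine Submodule.subset_span ⟨(l.map (fun a => -a)).reverse, ?_⟩
      simp [op_list_prod, List.map_map, Function.comp_def]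
    | zero => exact zero_mem _
    | add x y _ _ hx hy => rw [op_add]; exact add_mem hx hy
    | smul c x _ hx => rw [op_smul]; exact Submodule.smul_mem _ c hx

/-- Theorem 5.5 (noether-cycle): `K[C_n]` is left and right Noetherian. -/
theorem stmt17 (n : ℕ) (hn : 3 ≤ n) (K : Type*) [Field K] :
    IsNoetherianRing (MonoidAlgebra K (Cn n)) ∧
    IsNoetherianRing (MonoidAlgebra K (Cn n))ᵐᵒᵖ := by
  exact ⟨gen_noeth hn K (gx n K) (gx1 n K) (gx2 n K) (gx3 n K) (gx4 n K) (gx_span n K),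
    op_noeth n hn K⟩

end HK
end

section
/- Let Θ = (V, E) be a finite simple oriented graph and K a field. The following are equivalent: (1) the monoid algebra K[HK_Θ] is right Noetherian; (2) K[HK_Θ] is left Noetherian; (3) every connected component of Θ is either an oriented cycle or acyclic. -/
namespace HK

/-- The defining relations of the Hecke–Kiselman monoid of an oriented graph
with vertex set `V` and arrow relation `E`. -/
def hkRelG {V : Type*} (E : V → V → Prop) :
    FreeMonoid V → FreeMonoid V → Prop := fun w v =>
  (∃ a : V, w = FreeMonoid.of a * FreeMonoid.of a ∧ v = FreeMonoid.of a) ∨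
  (∃ a b : V, a ≠ b ∧ ¬ E a b ∧ ¬ E b a ∧
    w = FreeMonoid.of a * FreeMonoid.of b ∧ v = FreeMonoid.of b * FreeMonoid.of a) ∨
  (∃ a b : V, E a b ∧
    (w = FreeMonoid.of a * FreeMonoid.of b * FreeMonoid.of a ∨
     w = FreeMonoid.of b * FreeMonoid.of a * FreeMonoid.of b) ∧
    v = FreeMonoid.of a * FreeMonoid.of b)

/-- The Hecke–Kiselman monoid of the oriented graph `(V, E)`. -/
abbrev HKMonoid {V : Type*} (E : V → V → Prop) := (conGen (hkRelG E)).Quotient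

/-- The connected component of the vertex `v` (with respect to the equivalence
relation generated by `E v w ∨ E w v`). -/
def comp {V : Type*} (E : V → V → Prop) (v : V) : Set V :=
  {w | Relation.EqvGen (fun a b => E a b ∨ E b a) v w}

/-- `S` contains no oriented cycle of `E`. -/
def AcyclicOn {V : Type*} (E : V → V → Prop) (S : Set V) : Prop :=
  ¬ ∃ (m : ℕ) (c : ℕ → V), 1 ≤ m ∧ c m = c 0 ∧ (∀ t, t ≤ m → c t ∈ S) ∧
      ∀ t, t < m → E (c t) (c (t + 1))

/-- `S` is an oriented cycle: for some `m ≥ 3` there is a bijection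
`φ : S → ℤ/mℤ` with `E v w ↔ φ w = φ v + 1`. -/
def IsCycleOn {V : Type*} (E : V → V → Prop) (S : Set V) : Prop :=
  ∃ m : ℕ, 3 ≤ m ∧ ∃ φ : S ≃ ZMod m, ∀ v w : S, E v w ↔ φ w = φ v + 1

/-! ### Generators and the universal property -/

/-- The generator attached to a vertex. -/
def gen {V : Type*} (E : V → V → Prop) (a : V) : HKMonoid E :=
  ((FreeMonoid.of a : FreeMonoid V) : (conGen (hkRelG E)).Quotient)

section basics
variable {V : Type*} {E : V → V → Prop}

theorem gen_rel {w v : FreeMonoid V} (h : hkRelG E w v) :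
    ((w : (conGen (hkRelG E)).Quotient)) = (v : (conGen (hkRelG E)).Quotient) :=
  (Con.eq _).2 (ConGen.Rel.of _ _ h)

theorem gen_idem (a : V) : gen E a * gen E a = gen E a :=
  gen_rel (E := E) (Or.inl ⟨a, rfl, rfl⟩)

theorem gen_comm {a b : V} (h1 : ¬ E a b) (h2 : ¬ E b a) :
    gen E a * gen E b = gen E b * gen E a := by
  by_cases hab : a = b
  · rw [hab]
  · exact gen_rel (E := E) (Or.inr (Or.inl ⟨a, b, hab, h1, h2, rfl, rfl⟩))

theorem gen_aba {a b : V} (h : E a b) :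
    gen E a * gen E b * gen E a = gen E a * gen E b :=
  gen_rel (E := E) (Or.inr (Or.inr ⟨a, b, h, Or.inl rfl, rfl⟩))

theorem gen_bab {a b : V} (h : E a b) :
    gen E b * gen E a * gen E b = gen E a * gen E b :=
  gen_rel (E := E) (Or.inr (Or.inr ⟨a, b, h, Or.inr rfl, rfl⟩))

/-- Universal property. -/
def hkLift {N : Type*} [Monoid N] (g : V → N)
    (h1 : ∀ a, g a * g a = g a)
    (h2 : ∀ a b, a ≠ b → ¬ E a b → ¬ E b a → g a * g b = g b * g a)
    (h3 : ∀ a b, E a b → g a * g b * g a = g a * g b)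
    (h4 : ∀ a b, E a b → g b * g a * g b = g a * g b) : HKMonoid E →* N :=
  Con.lift _ (FreeMonoid.lift g) (Con.conGen_le.2 (by
    rintro w v (⟨a, rfl, rfl⟩ | ⟨a, b, hab, hE1, hE2, rfl, rfl⟩ | ⟨a, b, hE, (rfl | rfl), rfl⟩)
    · simpa [Con.ker_rel] using h1 a
    · simpa [Con.ker_rel] using h2 a b hab hE1 hE2
    · simpa [Con.ker_rel] using h3 a b hE
    · simpa [Con.ker_rel] using h4 a b hE))

theorem hkLift_gen {N : Type*} [Monoid N] (g : V → N) (h1 h2 h3 h4) (a : V) :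
    hkLift (E := E) g h1 h2 h3 h4 (gen E a) = g a := by
  unfold hkLift gen
  rw [Con.lift_coe, FreeMonoid.lift_eval_of]

theorem closure_gen : Submonoid.closure (Set.range (gen E)) = ⊤ := by
  rw [eq_top_iff]
  rintro x -
  refine Con.induction_on x fun w => ?_
  induction w using FreeMonoid.inductionOn' with
  | one => exact Submonoid.one_mem _
  | of_mul a w ih =>
    exact Submonoid.mul_mem (Submonoid.closure (Set.range (gen E)))
      (Submonoid.subset_closure (Set.mem_range_self a)) ih

theorem ind_left {p : HKMonoid E → Prop} (x : HKMonoid E) (one : p 1)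
    (mul : ∀ a x, p x → p (gen E a * x)) : p x := by
  have hx : x ∈ Submonoid.closure (Set.range (gen E)) := by rw [closure_gen]; trivial
  induction hx using Submonoid.closure_induction_left with
  | one => exact one
  | mul_left a ha y _ ih => obtain ⟨a, rfl⟩ := ha; exact mul a y ih

theorem ind_right {p : HKMonoid E → Prop} (x : HKMonoid E) (one : p 1)
    (mul : ∀ x a, p x → p (x * gen E a)) : p x := by
  have hx : x ∈ Submonoid.closure (Set.range (gen E)) := by rw [closure_gen]; trivial
  induction hx using Submonoid.closure_induction_right with
  | one => exact one
  | mul_right x _ a ha ih => obtain ⟨a, rfl⟩ := ha; exact mul x a ih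

/-- submonoid generated by the letters of `S` -/
def HS (E : V → V → Prop) (S : Set V) : Submonoid (HKMonoid E) :=
  Submonoid.closure (gen E '' S)

theorem HS_univ : HS E Set.univ = ⊤ := by
  unfold HS; rw [Set.image_univ, closure_gen]

theorem src_absorb {S : Set V} {a : V} (ha : ∀ c ∈ S, ¬ E c a) {u : HKMonoid E}
    (hu : u ∈ HS E S) : gen E a * u * gen E a = gen E a * u := by
  unfold HS at hu
  induction hu using Submonoid.closure_induction_right with
  | one => simp [gen_idem]
  | mul_right u _ c hc ih =>
    obtain ⟨c, hc, rfl⟩ := hc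
    by_cases h : E a c
    · calc gen E a * (u * gen E c) * gen E a = (gen E a * u) * gen E c * gen E a := by
            simp only [mul_assoc]
        _ = (gen E a * u * gen E a) * gen E c * gen E a := by rw [ih]
        _ = gen E a * u * (gen E a * gen E c * gen E a) := by simp only [mul_assoc]
        _ = (gen E a * u * gen E a) * gen E c := by rw [gen_aba h]; simp only [mul_assoc]
        _ = gen E a * (u * gen E c) := by rw [ih]; simp only [mul_assoc]
    · calc gen E a * (u * gen E c) * gen E a = (gen E a * u) * (gen E c * gen E a) := by
            simp only [mul_assoc]
        _ = (gen E a * u * gen E a) * gen E c := by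
            rw [gen_comm (ha c hc) h]; simp only [mul_assoc]
        _ = gen E a * (u * gen E c) := by rw [ih]; simp only [mul_assoc]

/-- If `E' ≤ E`, then `HK E` maps onto `HK E'`. -/
theorem surj_of_sub {E' : V → V → Prop} (h : ∀ a b, E' a b → E a b)
    (hs : ∀ a b, E a b → ¬ E b a) :
    ∃ f : HKMonoid E →* HKMonoid E', Function.Surjective f := by
  suffices H : ∃ f : HKMonoid E →* HKMonoid E', ∀ a, f (gen E a) = gen E' a by
    obtain ⟨f, hf⟩ := H
    refine ⟨f, fun x => ind_left (p := fun x => ∃ y, f y = x) x ⟨1, map_one _⟩ ?_⟩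
    rintro a x ⟨y, rfl⟩
    exact ⟨gen E a * y, by rw [map_mul, hf]⟩
  refine ⟨hkLift (gen E') gen_idem ?_ ?_ ?_, fun a => hkLift_gen _ _ _ _ _ a⟩
  · intro a b _ h1 h2
    exact gen_comm (fun h' => h1 (h _ _ h')) (fun h' => h2 (h _ _ h'))
  · intro a b hab
    by_cases h' : E' a b
    · exact gen_aba h'
    · have h'' : ¬ E' b a := fun h3 => hs _ _ hab (h _ _ h3)
      rw [mul_assoc, ← gen_comm h' h'', ← mul_assoc, gen_idem]
  · intro a b hab
    by_cases h' : E' a b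
    · exact gen_bab h'
    · have h'' : ¬ E' b a := fun h3 => hs _ _ hab (h _ _ h3)
      rw [← gen_comm h' h'', mul_assoc, gen_idem]

/-- reversing words -/
theorem flip_equiv : Nonempty ((HKMonoid E)ᵐᵒᵖ ≃* HKMonoid (flip E)) := by
  let f : HKMonoid E →* (HKMonoid (flip E))ᵐᵒᵖ :=
    hkLift (fun a => MulOpposite.op (gen (flip E) a))
      (fun a => by rw [← MulOpposite.op_mul, gen_idem])
      (fun a b _ h1 h2 => by
        rw [← MulOpposite.op_mul, ← MulOpposite.op_mul, gen_comm (E := flip E) h1 h2])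
      (fun a b h => by
        simp only [← MulOpposite.op_mul]
        rw [← mul_assoc, gen_bab (E := flip E) h])
      (fun a b h => by
        simp only [← MulOpposite.op_mul]
        rw [← mul_assoc, gen_aba (E := flip E) h])
  let g : HKMonoid (flip E) →* (HKMonoid E)ᵐᵒᵖ :=
    hkLift (fun a => MulOpposite.op (gen E a))
      (fun a => by rw [← MulOpposite.op_mul, gen_idem])
      (fun a b _ h1 h2 => by
        rw [← MulOpposite.op_mul, ← MulOpposite.op_mul, gen_comm (E := E) (a := b) (b := a) h1 h2])
      (fun a b h => by
        simp only [← MulOpposite.op_mul]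
        rw [← mul_assoc, gen_bab (E := E) h])
      (fun a b h => by
        simp only [← MulOpposite.op_mul]
        rw [← mul_assoc, gen_aba (E := E) h])
  have hfg : ∀ x, f (g x).unop = MulOpposite.op x := by
    intro x
    refine ind_left (p := fun x => f (g x).unop = MulOpposite.op x) x (by simp) ?_
    intro a x ih
    rw [map_mul, MulOpposite.unop_mul, map_mul, ih, hkLift_gen, MulOpposite.unop_op,
      hkLift_gen, ← MulOpposite.op_mul]
  have hgf : ∀ x, g (f x).unop = MulOpposite.op x := by
    intro x
    refine ind_left (p := fun x => g (f x).unop = MulOpposite.op x) x (by simp) ?_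
    intro a x ih
    rw [map_mul, MulOpposite.unop_mul, map_mul, ih, hkLift_gen, MulOpposite.unop_op,
      hkLift_gen, ← MulOpposite.op_mul]
  refine ⟨⟨⟨fun x => (f x.unop).unop, fun y => g y, ?_, ?_⟩, ?_⟩⟩
  · intro x; simp only [hgf]; simp
  · intro x; simp only [hfg]; simp
  · intro x y; simp

end basics

/-! ### Tokens moving along a walk -/

section token
variable {V : Type*} {E : V → V → Prop} {X : Type*}

open Classical in
/-- one step of a token -/
noncomputable def stp (c : X → V) (nxt : X → X) (a : V) : X → X :=
  fun t => if c t = a then nxt t else t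

theorem stp_eq {c : X → V} {nxt : X → X} {t : X} : stp c nxt (c t) t = nxt t := by
  simp [stp]

theorem stp_ne {c : X → V} {nxt : X → X} {a : V} {t : X} (h : c t ≠ a) : stp c nxt a t = t := by
  simp [stp, h]

/-- the (right) action of the monoid on the positions of a walk -/
noncomputable def tok (hirr : ∀ v, ¬ E v v) (hs : ∀ a b, E a b → ¬ E b a)
    (c : X → V) (nxt : X → X) (hc : ∀ t, E (c t) (c (nxt t))) :
    HKMonoid E →* (Function.End X)ᵐᵒᵖ :=
  hkLift (fun a => MulOpposite.op (stp c nxt a : Function.End X))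
    (by
      intro a
      refine MulOpposite.unop_injective (funext fun t => ?_)
      change stp c nxt a (stp c nxt a t) = stp c nxt a t
      by_cases h : c t = a
      · subst h
        have := hc t
        rw [stp_eq, stp_ne]
        intro h; rw [h] at this; exact hirr _ this
      · simp [stp, h])
    (by
      intro a b hab h1 h2
      refine MulOpposite.unop_injective (funext fun t => ?_)
      change stp c nxt b (stp c nxt a t) = stp c nxt a (stp c nxt b t)
      have := hc t
      simp only [stp]
      grind)
    (by
      intro a b hab
      refine MulOpposite.unop_injective (funext fun t => ?_)
      change stp c nxt a (stp c nxt b (stp c nxt a t)) = stp c nxt b (stp c nxt a t)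
      have h1 := hc t
      have h2 := hc (nxt t)
      have h3 := hs _ _ hab
      simp only [stp]
      grind)
    (by
      intro a b hab
      refine MulOpposite.unop_injective (funext fun t => ?_)
      change stp c nxt b (stp c nxt a (stp c nxt b t)) = stp c nxt b (stp c nxt a t)
      have h1 := hc t
      have h2 := hc (nxt t)
      have h3 := hs _ _ hab
      simp only [stp]
      grind)

/-- the position of the token `t` after applying `h` -/
noncomputable def pos (hirr : ∀ v, ¬ E v v) (hs : ∀ a b, E a b → ¬ E b a)
    (c : X → V) (nxt : X → X) (hc : ∀ t, E (c t) (c (nxt t))) (h : HKMonoid E) : X → X :=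
  (tok hirr hs c nxt hc h).unop

variable (hirr : ∀ v, ¬ E v v) (hs : ∀ a b, E a b → ¬ E b a)
    (c : X → V) (nxt : X → X) (hc : ∀ t, E (c t) (c (nxt t)))

theorem pos_one (t : X) : pos hirr hs c nxt hc 1 t = t := by
  simp only [pos, map_one]; rfl

theorem pos_mul (x y : HKMonoid E) (t : X) :
    pos hirr hs c nxt hc (x * y) t = pos hirr hs c nxt hc y (pos hirr hs c nxt hc x t) := by
  simp only [pos, map_mul]; rfl

theorem pos_gen (a : V) (t : X) :
    pos hirr hs c nxt hc (gen E a) t = stp c nxt a t := by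
  simp only [pos, tok, hkLift_gen]; rfl

end token
/-! ### Non-Noetherian part -/

section nonnoeth
variable {M : Type*} [Monoid M] (K : Type*) [Field K]

theorem not_noeth (d : ℕ → MonoidAlgebra K M) (l : ℕ → MonoidAlgebra K M →ₗ[K] K)
    (h0 : ∀ k b, b < k → ∀ h : M, l k (MonoidAlgebra.single h 1 * d b) = 0)
    (h1 : ∀ k, l k (d k) ≠ 0) : ¬ IsNoetherianRing (MonoidAlgebra K M) := by
  intro hN
  let J : ℕ →o Ideal (MonoidAlgebra K M) :=
    ⟨fun k => Ideal.span (d '' Set.Iio k), fun a b hab =>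
      Ideal.span_mono (Set.image_mono (Set.Iio_subset_Iio hab))⟩
  obtain ⟨n, hn⟩ := monotone_stabilizes_iff_noetherian.2 hN J
  have hd : d n ∈ J (n + 1) := Ideal.subset_span ⟨n, by simp, rfl⟩
  rw [← hn (n + 1) (by omega)] at hd
  have key : ∀ r ∈ J n, ∀ x : MonoidAlgebra K M, l n (x * r) = 0 := by
    intro r hr
    change r ∈ Submodule.span _ _ at hr
    induction hr using Submodule.span_induction with
    | mem y hy =>
      obtain ⟨b, hb, rfl⟩ := hy
      intro x
      induction x using MonoidAlgebra.induction_linear with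
      | zero => simp
      | add f g hf hg => rw [add_mul, map_add, hf, hg, add_zero]
      | single h c =>
        have : (MonoidAlgebra.single h c : MonoidAlgebra K M)
            = c • MonoidAlgebra.single h (1 : K) := by simp
        rw [this, smul_mul_assoc, map_smul, h0 n b hb h, smul_zero]
    | zero => intro x; simp
    | add y z _ _ hy hz => intro x; rw [mul_add, map_add, hy, hz, add_zero]
    | smul a y _ hy => intro x; rw [smul_eq_mul, ← mul_assoc, hy]
  apply h1 n
  simpa using key _ hd 1

open Classical in
/-- The functional summing the coefficients over a set. -/
noncomputable def fnl (P : M → Prop) : MonoidAlgebra K M →ₗ[K] K :=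
  (Finsupp.linearCombination K (fun h => if P h then (1 : K) else 0)) ∘ₗ
    (MonoidAlgebra.coeffLinearEquiv K).toLinearMap

open Classical in
theorem fnl_single (P : M → Prop) (h : M) :
    fnl K P (MonoidAlgebra.single h 1) = if P h then 1 else 0 := by
  simp [fnl, MonoidAlgebra.coeffLinearEquiv]

theorem not_noeth_of_seq (a : ℕ → M) (h : ∀ k j, j < k → ∀ x, x * a j ≠ a k) :
    ¬ IsNoetherianRing (MonoidAlgebra K M) := by
  refine not_noeth K (fun k => MonoidAlgebra.single (a k) 1) (fun k => fnl K (fun x => x = a k))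
    ?_ ?_
  · intro k b hb x
    rw [MonoidAlgebra.single_mul_single, one_mul, fnl_single, if_neg (h k b hb x)]
  · intro k
    rw [fnl_single, if_pos rfl]; exact one_ne_zero

theorem noeth_of_surj {N : Type*} [Monoid N] (f : M →* N) (hf : Function.Surjective f)
    (h : IsNoetherianRing (MonoidAlgebra K M)) : IsNoetherianRing (MonoidAlgebra K N) := by
  refine isNoetherianRing_of_surjective _ _ (MonoidAlgebra.mapDomainRingHom K f) ?_
  intro x
  induction x using MonoidAlgebra.induction_linear with
  | zero => exact ⟨0, map_zero _⟩
  | add x y hx hy =>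
    obtain ⟨x, rfl⟩ := hx
    obtain ⟨y, rfl⟩ := hy
    exact ⟨x + y, map_add _ _ _⟩
  | single n c =>
    obtain ⟨m, rfl⟩ := hf n
    exact ⟨MonoidAlgebra.single m c, by simp⟩

theorem noeth_op_iff {V : Type*} {E : V → V → Prop} :
    IsNoetherianRing (MonoidAlgebra K (HKMonoid E))ᵐᵒᵖ ↔
      IsNoetherianRing (MonoidAlgebra K (HKMonoid (flip E))) := by
  obtain ⟨e⟩ := flip_equiv (E := E)
  have e1a : (MonoidAlgebra K (HKMonoid E))ᵐᵒᵖ ≃+* MonoidAlgebra Kᵐᵒᵖ (HKMonoid E)ᵐᵒᵖ :=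
    MonoidAlgebra.opRingEquiv
  have e1b : MonoidAlgebra Kᵐᵒᵖ (HKMonoid E)ᵐᵒᵖ ≃+* MonoidAlgebra K (HKMonoid E)ᵐᵒᵖ :=
    MonoidAlgebra.mapRingEquiv (HKMonoid E)ᵐᵒᵖ (RingEquiv.toOpposite K).symm
  have e1c : MonoidAlgebra K (HKMonoid E)ᵐᵒᵖ ≃+* MonoidAlgebra K (HKMonoid (flip E)) :=
    (MonoidAlgebra.domCongr K K e).toRingEquiv
  have e1 := (e1a.trans e1b).trans e1c
  exact ⟨fun h => isNoetherianRing_of_ringEquiv _ e1,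
    fun h => isNoetherianRing_of_ringEquiv _ e1.symm⟩

end nonnoeth

section pendant
variable {V : Type*} {m : ℕ} (c : ZMod m → V) (v : V) (i0 : ZMod m)

/-- a cycle with an arrow pointing into it -/
def Epen : V → V → Prop := fun a b =>
  (∃ i, a = c i ∧ b = c (i + 1)) ∨ (a = v ∧ b = c i0)

/-- the walk starting in the extra vertex -/
def wk : ℕ → V
  | 0 => v
  | t + 1 => c (i0 + t)

variable (hm : 3 ≤ m) (hinj : Function.Injective c) (hv : ∀ i, c i ≠ v)
include hm hinj hv

theorem Epen_irr (a : V) : ¬ Epen c v i0 a a := by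
  rintro (⟨i, rfl, h⟩ | ⟨rfl, h⟩)
  · have h2 := hinj h
    have : Fact (1 < m) := ⟨by omega⟩
    simp at h2
  · exact hv _ h.symm

theorem Epen_asymm (a b : V) : Epen c v i0 a b → ¬ Epen c v i0 b a := by
  rintro (⟨i, rfl, rfl⟩ | ⟨rfl, rfl⟩) (⟨j, h1, h2⟩ | ⟨h1, h2⟩)
  · have h1 := hinj h1
    have h2 := hinj h2
    rw [← h1, add_assoc] at h2
    have h3 : ((2 : ℕ) : ZMod m) = 0 := by
      push_cast; rw [← one_add_one_eq_two]; simpa using h2.symm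
    rw [ZMod.natCast_eq_zero_iff] at h3
    have := Nat.le_of_dvd (by norm_num) h3
    omega
  · exact hv _ h1
  · exact hv _ h2.symm
  · exact hv _ h1

omit hm hinj hv in
theorem Epen_wk (t : ℕ) : Epen c v i0 (wk c v i0 t) (wk c v i0 (t + 1)) := by
  cases t with
  | zero => right; simp [wk]
  | succ t => left; exact ⟨i0 + t, rfl, by simp [wk, add_assoc]⟩

/-- token position -/
noncomputable def pp (h : HKMonoid (Epen c v i0)) : ℕ → ℕ :=
  pos (Epen_irr c v i0 hm hinj hv) (Epen_asymm c v i0 hm hinj hv) (wk c v i0) (fun t => t + 1)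
    (Epen_wk c v i0) h

theorem pp_one (t : ℕ) : pp c v i0 hm hinj hv 1 t = t := pos_one ..
theorem pp_mul (x y) (t : ℕ) : pp c v i0 hm hinj hv (x * y) t =
  pp c v i0 hm hinj hv y (pp c v i0 hm hinj hv x t) := pos_mul ..
theorem pp_gen (a : V) (t : ℕ) : pp c v i0 hm hinj hv (gen _ a) t =
  stp (wk c v i0) (fun t => t + 1) a t := pos_gen ..

theorem pp_gen_zero (a : V) (h : a ≠ v) : pp c v i0 hm hinj hv (gen _ a) 0 = 0 := by
  rw [pp_gen, stp_ne]; exact h.symm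

theorem pp_gen_v : pp c v i0 hm hinj hv (gen _ v) 0 = 1 := by
  rw [pp_gen]; exact stp_eq (c := wk c v i0) (t := 0)

theorem pp_gen_v_succ (t : ℕ) : pp c v i0 hm hinj hv (gen _ v) (t + 1) = t + 1 := by
  rw [pp_gen, stp_ne]; exact hv _

/-- partial turns around the cycle -/
def trn : ℕ → HKMonoid (Epen c v i0)
  | 0 => 1
  | t + 1 => trn t * gen _ (c (i0 + t))

theorem pp_trn_zero (s : ℕ) : pp c v i0 hm hinj hv (trn c v i0 s) 0 = 0 := by
  induction s with
  | zero => exact pp_one ..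
  | succ s ih => rw [trn, pp_mul, ih, pp_gen_zero _ _ _ _ _ _ _ (hv _)]

theorem pp_trn (k s : ℕ) :
    pp c v i0 hm hinj hv (trn c v i0 s) (1 + k * m) = 1 + k * m + s := by
  induction s with
  | zero => exact pp_one ..
  | succ s ih =>
    rw [trn, pp_mul, ih, pp_gen]
    have : c (i0 + s) = wk c v i0 (1 + k * m + s) := by
      rw [show 1 + k * m + s = (k * m + s) + 1 by ring, wk]
      simp
    rw [this]; exact stp_eq

theorem pp_pow (k b : ℕ) :
    pp c v i0 hm hinj hv (trn c v i0 m ^ b) (1 + k * m) = 1 + (k + b) * m := by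
  induction b with
  | zero => simp [pp_one]
  | succ b ih =>
    rw [pow_succ, pp_mul, ih, pp_trn]; ring

theorem pp_pow_zero (b : ℕ) : pp c v i0 hm hinj hv (trn c v i0 m ^ b) 0 = 0 := by
  induction b with
  | zero => simp [pp_one]
  | succ b ih => rw [pow_succ, pp_mul, ih, pp_trn_zero]

theorem v_absorb (u : HKMonoid (Epen c v i0)) : gen _ v * u * gen _ v = gen _ v * u := by
  refine src_absorb (S := Set.univ) ?_ (by rw [HS_univ]; trivial)
  rintro a - (⟨i, rfl, h⟩ | ⟨rfl, h⟩)
  · exact hv _ h.symm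
  · exact hv _ h.symm

theorem pp_or (h : HKMonoid (Epen c v i0)) : pp c v i0 hm hinj hv h 0 = 0 ∨
    ∃ u1 u2, h = u1 * gen _ v * u2 := by
  refine ind_right (p := fun h => pp c v i0 hm hinj hv h 0 = 0 ∨
    ∃ u1 u2, h = u1 * gen _ v * u2) h (Or.inl (pp_one ..)) ?_
  rintro h a (h1 | ⟨u1, u2, rfl⟩)
  · by_cases ha : a = v
    · right; exact ⟨h, 1, by rw [ha, mul_one]⟩
    · left; rw [pp_mul, h1, pp_gen_zero _ _ _ _ _ _ _ ha]
  · right; exact ⟨u1, u2 * gen _ a, by simp only [mul_assoc]⟩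

theorem pen_left (K : Type*) [Field K] :
    ¬ IsNoetherianRing (MonoidAlgebra K (HKMonoid (Epen c v i0))) := by
  set w := trn c v i0 m with hw
  set x := gen (Epen c v i0) v with hx
  have hpA : ∀ h b, pp c v i0 hm hinj hv h 0 = 0 →
      pp c v i0 hm hinj hv (h * (w * x * w ^ b)) 0 = 1 + b * m := by
    intro h b h0
    rw [pp_mul, h0, pp_mul, pp_mul, pp_trn_zero, pp_gen_v]
    simpa using pp_pow c v i0 hm hinj hv 0 b
  have hpB : ∀ h b, pp c v i0 hm hinj hv h 0 = 0 →
      pp c v i0 hm hinj hv (h * (x * w ^ (b + 1))) 0 = 1 + (b + 1) * m := by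
    intro h b h0
    rw [pp_mul, h0, pp_mul, pp_gen_v]
    simpa using pp_pow c v i0 hm hinj hv 0 (b + 1)
  refine not_noeth K
    (fun b => MonoidAlgebra.single (w * x * w ^ b) 1 - MonoidAlgebra.single (x * w ^ (b + 1)) 1)
    (fun k => fnl K (fun h => pp c v i0 hm hinj hv h 0 = 1 + (k + 1) * m)) ?_ ?_
  · intro k b hbk h
    rw [mul_sub, MonoidAlgebra.single_mul_single, MonoidAlgebra.single_mul_single, one_mul]
    rcases pp_or c v i0 hm hinj hv h with h0 | ⟨u1, u2, rfl⟩
    · rw [map_sub, fnl_single, fnl_single, hpA h b h0, hpB h b h0, if_neg, if_neg, sub_zero]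
      · intro h3
        have : (b + 1) * m < (k + 1) * m := Nat.mul_lt_mul_of_pos_right (by omega) (by omega)
        omega
      · intro h3
        have : b * m < (k + 1) * m := Nat.mul_lt_mul_of_pos_right (by omega) (by omega)
        omega
    · have e1 : u1 * x * u2 * (w * x * w ^ b) = u1 * (x * (u2 * w) * x) * w ^ b := by
        simp only [mul_assoc]
      have e2 : u1 * x * u2 * (x * w ^ (b + 1)) = u1 * (x * u2 * x) * w ^ (b + 1) := by
        simp only [mul_assoc]
      rw [e1, e2, v_absorb c v i0 hm hinj hv, v_absorb c v i0 hm hinj hv, pow_succ']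
      simp only [mul_assoc, sub_self, map_zero]
  · intro k
    have hA := hpA 1 k (pp_one ..)
    have hB := hpB 1 k (pp_one ..)
    rw [one_mul] at hA hB
    rw [map_sub, fnl_single, fnl_single, hA, hB, if_neg, if_pos rfl]
    · simp
    · intro h3
      have : k * m < (k + 1) * m := Nat.mul_lt_mul_of_pos_right (by omega) (by omega)
      omega

theorem pp_shift (h : HKMonoid (Epen c v i0)) (j : ℕ) (t : ℕ) :
    pp c v i0 hm hinj hv h (t + 1 + j * m) = pp c v i0 hm hinj hv h (t + 1) + j * m ∧
    1 ≤ pp c v i0 hm hinj hv h (t + 1) := by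
  refine ind_right (p := fun h =>
    pp c v i0 hm hinj hv h (t + 1 + j * m) = pp c v i0 hm hinj hv h (t + 1) + j * m ∧
    1 ≤ pp c v i0 hm hinj hv h (t + 1)) h (by simp [pp_one]) ?_
  rintro h a ⟨h1, h2⟩
  rw [pp_mul, pp_mul, h1, pp_gen, pp_gen]
  obtain ⟨s, hs⟩ : ∃ s, pp c v i0 hm hinj hv h (t + 1) = s + 1 := ⟨_, (Nat.sub_add_cancel h2).symm⟩
  rw [hs]
  have e : wk c v i0 (s + 1 + j * m) = wk c v i0 (s + 1) := by
    rw [show s + 1 + j * m = s + j * m + 1 by ring, wk, wk]; simp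
  by_cases ha : wk c v i0 (s + 1) = a
  · simp only [stp, e, ha, if_true]; exact ⟨by ring, by omega⟩
  · simp only [stp, e, ha, if_false]; exact ⟨trivial, by omega⟩

theorem pen_right (K : Type*) [Field K] :
    ¬ IsNoetherianRing (MonoidAlgebra K (HKMonoid (flip (Epen c v i0)))) := by
  obtain ⟨e⟩ := flip_equiv (E := Epen c v i0)
  refine not_noeth_of_seq K
    (fun k => e (MulOpposite.op (trn c v i0 m ^ k * gen _ v))) ?_
  intro k j hjk y hy
  obtain ⟨u, rfl⟩ := e.surjective y
  rw [← map_mul] at hy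
  have hy := congrArg MulOpposite.unop (e.injective hy)
  obtain ⟨u, rfl⟩ := MulOpposite.op_surjective u
  simp only [← MulOpposite.op_mul, MulOpposite.unop_op] at hy
  have e0 := congrArg (fun h => pp c v i0 hm hinj hv h 0) hy
  have e1 := congrArg (fun h => pp c v i0 hm hinj hv h (1 + 0 * m)) hy
  simp only [pp_mul, pp_pow_zero, pp_gen_v] at e0
  simp only [pp_mul, pp_pow] at e1
  have e2 := (pp_shift c v i0 hm hinj hv u j 0).1
  rw [add_comm 1 ((0 + j) * m), add_comm 1 ((0 + k) * m), pp_gen_v_succ, pp_gen_v_succ,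
    zero_add, zero_add, add_comm (j * m)] at e1
  rw [zero_add, e0, e1] at e2
  have : j * m < k * m := Nat.mul_lt_mul_of_pos_right hjk (by omega)
  omega

end pendant
/-! ### Shortest cycles -/

section graph
variable {V : Type*} {E : V → V → Prop}

theorem exists_pendant (hirr : ∀ v, ¬ E v v) (hs : ∀ a b, E a b → ¬ E b a) (v : V)
    (h1 : ¬ AcyclicOn E (comp E v)) (h2 : ¬ IsCycleOn E (comp E v)) :
    ∃ m : ℕ, 3 ≤ m ∧ ∃ c : ZMod m → V, Function.Injective c ∧ (∀ i, E (c i) (c (i + 1))) ∧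
      ∃ (u : V) (i0 : ZMod m), (∀ i, c i ≠ u) ∧ (E u (c i0) ∨ E (c i0) u) := by
  classical
  unfold AcyclicOn at h1
  rw [not_not] at h1
  set S := comp E v with hS
  have hmin : ∀ {k : ℕ}, k < Nat.find h1 → _ := fun {k} hk => Nat.find_min h1 hk
  obtain ⟨c, hm1, hc0, hcS, hcE⟩ := Nat.find_spec h1
  set m := Nat.find h1 with hm
  clear_value m
  have : NeZero m := ⟨by omega⟩
  let d : ZMod m → V := fun i => c i.val
  have hdS : ∀ i, d i ∈ S := fun i => hcS _ (ZMod.val_lt i).le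
  have hdE : ∀ i, E (d i) (d (i + 1)) := by
    intro i
    have hi := ZMod.val_lt i
    have := hcE _ hi
    have e : d (i + 1) = c (i.val + 1) := by
      change c (i + 1).val = _
      by_cases h : i.val + 1 < m
      · congr 1
        have e1 : (i + 1) = ((i.val + 1 : ℕ) : ZMod m) := by push_cast; simp
        rw [e1, ZMod.val_natCast, Nat.mod_eq_of_lt h]
      · have h' : i.val + 1 = m := by omega
        have e1 : (i + 1) = ((i.val + 1 : ℕ) : ZMod m) := by push_cast; simp
        rw [h', hc0, e1, h']; simp
    rw [e]; exact this
  have hwalk : ∀ (i : ZMod m) (k : ℕ), 1 ≤ k → k < m → d (i + k) ≠ d i := by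
    intro i k hk1 hkm hk
    refine hmin hkm ⟨fun t => d (i + t), hk1, by simpa using hk, fun t _ => hdS _, fun t _ => ?_⟩
    have := hdE (i + t)
    simpa [add_assoc] using this
  have hinj : Function.Injective d := by
    intro i j hij
    by_contra hne
    have hk : (j - i).val ≠ 0 := by
      rw [Ne, ZMod.val_eq_zero]; exact sub_ne_zero.2 (Ne.symm hne)
    refine hwalk i (j - i).val (by omega) (ZMod.val_lt _) ?_
    simp [hij]
  have hchord : ∀ i j, E (d i) (d j) → j = i + 1 := by
    intro i j hij
    set k := (i - j).val with hk
    have hkm : k < m := ZMod.val_lt _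
    have hjk : j + (k : ZMod m) = i := by simp [hk]
    by_cases hk' : k + 1 < m
    · exfalso
      refine hmin hk' ⟨fun t => if t ≤ k then d (j + t) else d j, by omega, by simp, ?_, ?_⟩
      · intro t _; dsimp only; split_ifs <;> exact hdS _
      · intro t ht
        dsimp only
        rw [if_pos (by omega)]
        by_cases htk : t + 1 ≤ k
        · rw [if_pos htk]
          have := hdE (j + t)
          simpa [add_assoc] using this
        · rw [if_neg htk]
          have : t = k := by omega
          rw [this, hjk]; exact hij
    · have : k + 1 = m := by omega
      have e2 : ((k + 1 : ℕ) : ZMod m) = 0 := by rw [this]; simp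
      rw [← hjk, add_assoc]
      push_cast at e2
      rw [e2, add_zero]
  have hm3 : 3 ≤ m := by
    by_contra hlt
    have h0 := hcE 0 (by omega)
    obtain h | h : m = 1 ∨ m = 2 := by omega
    · rw [zero_add, ← h, hc0] at h0; exact hirr _ h0
    · have h1' := hcE 1 (by omega)
      rw [show 1 + 1 = m by omega, hc0] at h1'
      exact hs _ _ h0 h1'
  refine ⟨m, hm3, d, hinj, hdE, ?_⟩
  by_contra hno
  push Not at hno
  apply h2
  have hcl : ∀ a b, E a b ∨ E b a → (a ∈ Set.range d ↔ b ∈ Set.range d) := by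
    have key : ∀ a b, E a b ∨ E b a → a ∈ Set.range d → b ∈ Set.range d := by
      rintro _ b hab ⟨i, rfl⟩
      by_contra hb
      have := hno b i (fun j hj => hb ⟨j, hj⟩)
      tauto
    exact fun a b hab => ⟨key a b hab, key b a hab.symm⟩
  have hcl' : ∀ a b, Relation.EqvGen (fun a b => E a b ∨ E b a) a b →
      (a ∈ Set.range d ↔ b ∈ Set.range d) := by
    intro a b h
    induction h with
    | rel a b h => exact hcl a b h
    | refl a => rfl
    | symm a b _ ih => exact ih.symm
    | trans a b e _ _ h1 h2 => exact h1.trans h2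
  have hvr : v ∈ Set.range d := (hcl' _ _ (hdS 0)).2 ⟨0, rfl⟩
  let ψ : ZMod m ≃ S := Equiv.ofBijective (fun i => ⟨d i, hdS i⟩) ⟨fun i j h => hinj (by
      simpa using h), fun ⟨w, hw⟩ => by
        obtain ⟨i, hi⟩ := (hcl' _ _ hw).1 hvr
        exact ⟨i, Subtype.ext hi⟩⟩
  refine ⟨m, hm3, ψ.symm, fun a b => ?_⟩
  obtain ⟨i, rfl⟩ := ψ.surjective a
  obtain ⟨j, rfl⟩ := ψ.surjective b
  rw [Equiv.symm_apply_apply, Equiv.symm_apply_apply]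
  constructor
  · exact hchord i j
  · rintro rfl; exact hdE i

theorem cond_of_noeth (hirr : ∀ v, ¬ E v v) (hs : ∀ a b, E a b → ¬ E b a)
    (K : Type*) [Field K] (hN : IsNoetherianRing (MonoidAlgebra K (HKMonoid E))) (v : V) :
    AcyclicOn E (comp E v) ∨ IsCycleOn E (comp E v) := by
  by_contra hcon
  rw [not_or] at hcon
  obtain ⟨m, hm, c, hinj, hcE, u, i0, hu, hE⟩ := exists_pendant hirr hs v hcon.1 hcon.2
  rcases hE with hE | hE
  · obtain ⟨f, hf⟩ := surj_of_sub (E := E) (E' := Epen c u i0) (by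
      rintro a b (⟨i, rfl, rfl⟩ | ⟨rfl, rfl⟩)
      · exact hcE i
      · exact hE) hs
    exact pen_left c u i0 hm hinj hu K (noeth_of_surj K f hf hN)
  · obtain ⟨f, hf⟩ := surj_of_sub (E := E) (E' := flip (Epen (fun i => c (-i)) u (-i0))) (by
      rintro a b (⟨i, rfl, rfl⟩ | ⟨rfl, rfl⟩)
      · have := hcE (-(i + 1))
        simpa using this
      · simpa using hE) hs
    exact pen_right _ u _ hm (fun i j h => neg_injective (hinj h)) (fun i => hu _) K
      (noeth_of_surj K f hf hN)

end graph
/-! ### Finiteness over a commutative subalgebra -/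

section fin
variable (K : Type*) [Field K] {R R' : Type*} [Ring R] [Algebra K R] [Ring R'] [Algebra K R']

/-- the algebra generated by `s` is a finite left module over a finitely generated commutative
subalgebra -/
def Pr (s : Set R) : Prop :=
  ∃ C : Subalgebra K R, C ≤ Algebra.adjoin K s ∧ (∀ x ∈ C, ∀ y ∈ C, x * y = y * x) ∧ C.FG ∧
    ∃ N : Submodule K R, N ≤ Subalgebra.toSubmodule (Algebra.adjoin K s) ∧ N.FG ∧
      Subalgebra.toSubmodule (Algebra.adjoin K s) ≤ Subalgebra.toSubmodule C * N

variable {K}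

theorem Pr.map {s : Set R} (h : Pr K s) (F : R →ₐ[K] R') : Pr K (F '' s) := by
  obtain ⟨C, hC, hcomm, hfg, N, hN, hNfg, hle⟩ := h
  have e : Algebra.adjoin K (F '' s) = (Algebra.adjoin K s).map F := (AlgHom.map_adjoin F s).symm
  refine ⟨C.map F, ?_, ?_, hfg.map F, N.map F.toLinearMap, ?_, hNfg.map _, ?_⟩
  · rw [e]; exact Subalgebra.map_mono hC
  · rintro _ ⟨x, hx, rfl⟩ _ ⟨y, hy, rfl⟩
    change F x * F y = F y * F x
    rw [← map_mul, ← map_mul, hcomm x hx y hy]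
  · rw [e]
    rintro _ ⟨x, hx, rfl⟩
    exact ⟨x, hN hx, rfl⟩
  · rw [e]
    rintro _ ⟨x, hx, rfl⟩
    have := Submodule.mem_map_of_mem (f := F.toLinearMap) (hle hx)
    rw [Submodule.map_mul] at this
    exact this

theorem Pr.of_finite {s : Set R} (h : (Submonoid.closure s : Set R).Finite) : Pr K s := by
  refine ⟨⊥, bot_le, ?_, Subalgebra.fg_bot, Subalgebra.toSubmodule (Algebra.adjoin K s), le_rfl,
    ?_, ?_⟩
  · intro x hx y hy
    obtain ⟨a, rfl⟩ := Algebra.mem_bot.1 hx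
    exact Algebra.commutes a y
  · rw [Algebra.adjoin_eq_span]
    exact ⟨h.toFinset, by simp⟩
  · intro x hx
    rw [← one_mul x]
    exact Submodule.mul_mem_mul (one_mem (⊥ : Subalgebra K R)) hx

theorem Pr.union {s t : Set R} (hs : Pr K s) (ht : Pr K t)
    (hst : ∀ x ∈ s, ∀ y ∈ t, x * y = y * x) : Pr K (s ∪ t) := by
  obtain ⟨C, hC, hcomm, hfg, N, hN, hNfg, hle⟩ := hs
  obtain ⟨C', hC', hcomm', hfg', N', hN', hNfg', hle'⟩ := ht
  have hAA : ∀ x ∈ Algebra.adjoin K s, ∀ y ∈ Algebra.adjoin K t, x * y = y * x := by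
    have h1 : ∀ x ∈ s, ∀ y ∈ Algebra.adjoin K t, x * y = y * x := by
      intro x hx
      have : Algebra.adjoin K t ≤ Subalgebra.centralizer K {x} := by
        rw [Algebra.adjoin_le_iff]
        intro y hy
        simp only [SetLike.mem_coe, Subalgebra.mem_centralizer_iff, Set.mem_singleton_iff]
        rintro _ rfl
        exact hst _ hx y hy
      intro y hy
      exact Subalgebra.mem_centralizer_iff K |>.1 (this hy) x rfl
    intro x hx y hy
    have : Algebra.adjoin K s ≤ Subalgebra.centralizer K {y} := by
      rw [Algebra.adjoin_le_iff]
      intro x hx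
      simp only [SetLike.mem_coe, Subalgebra.mem_centralizer_iff, Set.mem_singleton_iff]
      rintro _ rfl
      exact (h1 x hx _ hy).symm
    exact (Subalgebra.mem_centralizer_iff K |>.1 (this hx) y rfl).symm
  have hmonoS := Algebra.adjoin_mono (R := K) (Set.subset_union_left (s := s) (t := t))
  have hmonoT := Algebra.adjoin_mono (R := K) (Set.subset_union_right (s := s) (t := t))
  refine ⟨C ⊔ C', sup_le (hC.trans hmonoS) (hC'.trans hmonoT), ?_, hfg.sup hfg', N * N', ?_,
    hNfg.mul hNfg', ?_⟩
  · have k1 : C ⊔ C' ≤ Subalgebra.centralizer K C := by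
      refine sup_le ?_ ?_
      · intro x hx
        rw [Subalgebra.mem_centralizer_iff]
        intro y hy
        exact hcomm y hy x hx
      · intro x hx
        rw [Subalgebra.mem_centralizer_iff]
        intro y hy
        exact hAA y (hC hy) x (hC' hx)
    have k2 : C ⊔ C' ≤ Subalgebra.centralizer K C' := by
      refine sup_le ?_ ?_
      · intro x hx
        rw [Subalgebra.mem_centralizer_iff]
        intro y hy
        exact (hAA x (hC hx) y (hC' hy)).symm
      · intro x hx
        rw [Subalgebra.mem_centralizer_iff]
        intro y hy
        exact hcomm' y hy x hx
    have k3 : C ⊔ C' ≤ Subalgebra.centralizer K (C ⊔ C' : Subalgebra K R) := by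
      refine sup_le ?_ ?_
      · intro x hx
        rw [Subalgebra.mem_centralizer_iff]
        intro y hy
        exact (Subalgebra.mem_centralizer_iff K |>.1 (k1 hy) x hx).symm
      · intro x hx
        rw [Subalgebra.mem_centralizer_iff]
        intro y hy
        exact (Subalgebra.mem_centralizer_iff K |>.1 (k2 hy) x hx).symm
    intro x hx y hy
    exact (Subalgebra.mem_centralizer_iff K |>.1 (k3 hx) y hy).symm
  · rw [Submodule.mul_le]
    intro x hx y hy
    exact Subalgebra.mul_mem (Algebra.adjoin K (s ∪ t)) (hmonoS (hN hx)) (hmonoT (hN' hy))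
  · have hprod : ∀ x ∈ Submonoid.closure (s ∪ t), ∃ y ∈ Submonoid.closure s,
        ∃ z ∈ Submonoid.closure t, x = y * z := by
      intro x hx
      induction hx using Submonoid.closure_induction_right with
      | one => exact ⟨1, one_mem _, 1, one_mem _, by simp⟩
      | mul_right x _ g hg ih =>
        obtain ⟨y, hy, z, hz, rfl⟩ := ih
        rcases hg with hg | hg
        · refine ⟨y * g, mul_mem hy (Submonoid.subset_closure hg), z, hz, ?_⟩
          have hz' : z ∈ Algebra.adjoin K t := by
            rw [← Subalgebra.mem_toSubmodule, Algebra.adjoin_eq_span]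
            exact Submodule.subset_span hz
          rw [mul_assoc, mul_assoc, hAA g (Algebra.subset_adjoin hg) z hz']
        · exact ⟨y, hy, z * g, mul_mem hz (Submonoid.subset_closure hg), by rw [mul_assoc]⟩
    have hN2 : ∀ c' ∈ C', ∀ n ∈ N, n * c' = c' * n := fun c' hc' n hn =>
      hAA n (hN hn) c' (hC' hc')
    have step1 : Subalgebra.toSubmodule (Algebra.adjoin K (s ∪ t)) ≤
        Subalgebra.toSubmodule (Algebra.adjoin K s) *
          Subalgebra.toSubmodule (Algebra.adjoin K t) := by
      conv_lhs => rw [Algebra.adjoin_eq_span]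
      rw [Submodule.span_le]
      intro x hx
      obtain ⟨y, hy, z, hz, rfl⟩ := hprod x hx
      refine Submodule.mul_mem_mul ?_ ?_
      · rw [Algebra.adjoin_eq_span]; exact Submodule.subset_span hy
      · rw [Algebra.adjoin_eq_span]; exact Submodule.subset_span hz
    have step2 : N * Subalgebra.toSubmodule C' ≤ Subalgebra.toSubmodule C' * N := by
      rw [Submodule.mul_le]
      intro n hn c' hc'
      rw [hN2 c' hc' n hn]
      exact Submodule.mul_mem_mul hc' hn
    have step3 : Subalgebra.toSubmodule C * Subalgebra.toSubmodule C' ≤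
        Subalgebra.toSubmodule (C ⊔ C') := by
      rw [Submodule.mul_le]
      intro x hx y hy
      have h1 : C ≤ C ⊔ C' := le_sup_left
      have h2 : C' ≤ C ⊔ C' := le_sup_right
      exact Subalgebra.mul_mem (C ⊔ C') (h1 hx) (h2 hy)
    calc _ ≤ _ := step1
      _ ≤ (Subalgebra.toSubmodule C * N) * (Subalgebra.toSubmodule C' * N') :=
          mul_le_mul' hle hle'
      _ = Subalgebra.toSubmodule C * (N * Subalgebra.toSubmodule C') * N' := by
          simp only [mul_assoc]
      _ ≤ Subalgebra.toSubmodule C * (Subalgebra.toSubmodule C' * N) * N' :=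
          mul_le_mul' (mul_le_mul' le_rfl step2) le_rfl
      _ = (Subalgebra.toSubmodule C * Subalgebra.toSubmodule C') * (N * N') := by
          simp only [mul_assoc]
      _ ≤ _ := mul_le_mul' step3 le_rfl

theorem Pr.noeth {s : Set R} (h : Pr K s) (hs : Algebra.adjoin K s = ⊤) : IsNoetherianRing R := by
  obtain ⟨C, -, hcomm, hfg, N, -, ⟨G, hG⟩, hle⟩ := h
  let _ : CommRing C := { (inferInstance : Ring C) with
    mul_comm := fun x y => Subtype.ext (hcomm x x.2 y y.2) }
  have hft : Algebra.FiniteType K C := C.fg_iff_finiteType.1 hfg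
  have hCn : IsNoetherianRing C := Algebra.FiniteType.isNoetherianRing K C
  have hfin : Module.Finite C R := by
    refine ⟨⟨G, ?_⟩⟩
    rw [eq_top_iff]
    rintro x -
    have hx : x ∈ Subalgebra.toSubmodule C * N := hle (by rw [hs]; trivial)
    induction hx using Submodule.mul_induction_on' with
    | mem_mul_mem c hc n hn =>
      rw [← hG] at hn
      have hn' : n ∈ Submodule.span C (G : Set R) := by
        induction hn using Submodule.span_induction with
        | mem y hy => exact Submodule.subset_span hy
        | zero => exact zero_mem _
        | add y z _ _ hy hz => exact add_mem hy hz
        | smul a y _ hy =>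
          have := Submodule.smul_mem _ (algebraMap K C a) hy
          rwa [algebraMap_smul] at this
      exact Submodule.smul_mem _ (⟨c, hc⟩ : C) hn'
    | add x _ y _ hx hy => exact add_mem hx hy
  have : IsNoetherian C R := isNoetherian_of_isNoetherianRing_of_finite C R
  exact isNoetherian_of_tower C this

end fin

section acyclic
variable {V : Type*} {E : V → V → Prop}

theorem transGen_seq {r : V → V → Prop} {a b : V} (h : Relation.TransGen r a b) :
    ∃ (m : ℕ) (c : ℕ → V), 1 ≤ m ∧ c 0 = a ∧ c m = b ∧ ∀ t, t < m → r (c t) (c (t + 1)) := by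
  classical
  induction h with
  | single h =>
    rename_i b
    refine ⟨1, fun t => if t = 0 then a else b, le_rfl, by simp, by simp, ?_⟩
    intro t ht
    obtain rfl : t = 0 := by omega
    simpa using h
  | tail _ h ih =>
    rename_i b e _
    obtain ⟨m, c, hm, h0, h1, h2⟩ := ih
    refine ⟨m + 1, fun t => if t ≤ m then c t else e, by omega, by simpa using h0, by simp, ?_⟩
    intro t ht
    by_cases htm : t < m
    · simpa [htm.le, Nat.succ_le_of_lt htm] using h2 t htm
    · obtain rfl : t = m := by omega
      simpa [h1] using h

theorem HS_finite [Finite V] {S : Set V} (hS : AcyclicOn E S) :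
    (HS E S : Set (HKMonoid E)).Finite := by
  classical
  let r : V → V → Prop := fun a b => E a b ∧ a ∈ S ∧ b ∈ S
  have hirr : ∀ a, ¬ Relation.TransGen r a a := by
    intro a h
    obtain ⟨m, c, hm, h0, h1, h2⟩ := transGen_seq h
    refine hS ⟨m, c, hm, h1.trans h0.symm, ?_, fun t ht => (h2 t ht).1⟩
    intro t ht
    rcases Nat.lt_or_ge t m with h | h
    · exact (h2 t h).2.1
    · obtain rfl : t = m := by omega
      rw [h1, ← h0]; exact (h2 0 (by omega)).2.1
  have : IsTrans V (Relation.TransGen r) := ⟨fun _ _ _ => Relation.TransGen.trans⟩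
  have : Std.Irrefl (Relation.TransGen r) := ⟨hirr⟩
  have hwf : WellFounded (Relation.TransGen r) := Finite.wellFounded_of_trans_of_irrefl _
  have main : ∀ (n : ℕ) (T : Set V), T ⊆ S → T.ncard = n → (HS E T : Set (HKMonoid E)).Finite := by
    intro n
    induction n with
    | zero =>
      intro T _ h
      rw [Set.ncard_eq_zero] at h
      subst h
      simp [HS]
    | succ n ih =>
      intro T hT hn
      have hne : T.Nonempty := by
        rw [← Set.ncard_pos]; omega
      obtain ⟨a, haT, ha⟩ := hwf.has_min T hne
      have ha' : ∀ b ∈ T, ¬ E b a := fun b hb h =>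
        ha b hb (Relation.TransGen.single ⟨h, hT hb, hT haT⟩)
      have hfin := ih (T \ {a}) (Set.diff_subset.trans hT) (by
        rw [Set.ncard_diff_singleton_of_mem haT]; omega)
      set H := HS E (T \ {a}) with hH
      have hHT : H ≤ HS E T := Submonoid.closure_mono (Set.image_mono Set.diff_subset)
      have hfin2 : ((H : Set (HKMonoid E)) ∪
          Set.image2 (fun x y => x * gen E a * y) H H).Finite :=
        hfin.union (hfin.image2 _ hfin)
      refine hfin2.subset ?_
      intro x hx
      change x ∈ HS E T at hx
      have hx' : x ∈ Submonoid.closure (gen E '' T) := hx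
      clear hx
      induction hx' using Submonoid.closure_induction_right with
      | one => left; exact one_mem H
      | mul_right x _ g hg ihx =>
        obtain ⟨b, hb, rfl⟩ := hg
        by_cases hba : b = a
        · subst hba
          rcases ihx with hx | ⟨y, hy, z, hz, rfl⟩
          · right; exact ⟨x, hx, 1, one_mem H, by simp⟩
          · right
            refine ⟨y, hy, z, hz, ?_⟩
            have := src_absorb (E := E) (S := T) ha' (hHT hz)
            change y * gen E b * z = y * gen E b * z * gen E b
            rw [mul_assoc, mul_assoc, this]
        · have hbH : gen E b ∈ H := Submonoid.subset_closure ⟨b, ⟨hb, hba⟩, rfl⟩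
          rcases ihx with hx | ⟨y, hy, z, hz, rfl⟩
          · left; exact mul_mem hx hbH
          · right; exact ⟨y, hy, z * gen E b, mul_mem hz hbH, by simp only [mul_assoc]⟩
  exact main _ S le_rfl rfl

end acyclic

/-- the oriented cycle on `ZMod n` -/
def cycE (n : ℕ) : ZMod n → ZMod n → Prop := fun i j => j = i + 1

section assemble
variable {V : Type*} {E : V → V → Prop} (K : Type*) [Field K]

/-- the generators inside the algebra -/
noncomputable def agen (E : V → V → Prop) (a : V) : MonoidAlgebra K (HKMonoid E) :=
  MonoidAlgebra.of K _ (gen E a)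

theorem adjoin_agen : Algebra.adjoin K (Set.range (agen (E := E) K)) = ⊤ := by
  rw [eq_top_iff]
  rintro x -
  have key : ∀ h : HKMonoid E, MonoidAlgebra.of K _ h ∈
      Algebra.adjoin K (Set.range (agen (E := E) K)) := by
    intro h
    refine ind_left (p := fun h => MonoidAlgebra.of K _ h ∈
      Algebra.adjoin K (Set.range (agen (E := E) K))) h (by rw [map_one]; exact one_mem _) ?_
    intro a x hx
    rw [map_mul]
    exact mul_mem (Algebra.subset_adjoin ⟨a, rfl⟩) hx
  induction x using MonoidAlgebra.induction_linear with
  | zero => exact zero_mem _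
  | add f g hf hg => exact add_mem hf hg
  | single h c =>
    have : (MonoidAlgebra.single h c : MonoidAlgebra K (HKMonoid E))
        = c • MonoidAlgebra.of K _ h := by simp
    rw [this]
    exact Subalgebra.smul_mem _ (key h) c

theorem Pr_acyclic [Finite V] {S : Set V} (hS : AcyclicOn E S) : Pr K (agen (E := E) K '' S) := by
  apply Pr.of_finite
  have := HS_finite hS
  have e : Submonoid.closure (agen (E := E) K '' S) = (HS E S).map (MonoidAlgebra.of K _) := by
    rw [HS, MonoidHom.map_mclosure, Set.image_image]; rfl
  rw [e]
  exact this.image _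

theorem Pr_cycle (hcyc : ∀ n, 3 ≤ n → Pr K (Set.range (agen (E := cycE n) K)))
    {S : Set V} (hS : IsCycleOn E S) : Pr K (agen (E := E) K '' S) := by
  obtain ⟨n, hn, φ, hφ⟩ := hS
  have hE : ∀ i j : ZMod n, E (φ.symm i) (φ.symm j) ↔ cycE n i j := by
    intro i j; rw [hφ]; simp [cycE]
  let f : HKMonoid (cycE n) →* HKMonoid E := hkLift (fun i => gen E (φ.symm i))
    (fun a => gen_idem _)
    (fun a b _ h1 h2 => gen_comm (by rwa [hE]) (by rwa [hE]))
    (fun a b h => gen_aba (by rwa [hE]))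
    (fun a b h => gen_bab (by rwa [hE]))
  have := (hcyc n hn).map (MonoidAlgebra.mapDomainAlgHom K K f)
  convert this using 1
  rw [← Set.range_comp]
  ext x
  constructor
  · rintro ⟨a, ha, rfl⟩
    refine ⟨φ ⟨a, ha⟩, ?_⟩
    simp [agen, f, hkLift_gen]
  · rintro ⟨i, rfl⟩
    refine ⟨φ.symm i, (φ.symm i).2, ?_⟩
    simp [agen, f, hkLift_gen]

theorem noeth_of_cond [Finite V] (hcyc : ∀ n, 3 ≤ n → Pr K (Set.range (agen (E := cycE n) K)))
    (h : ∀ v : V, AcyclicOn E (comp E v) ∨ IsCycleOn E (comp E v)) :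
    IsNoetherianRing (MonoidAlgebra K (HKMonoid E)) := by
  classical
  let st : Setoid V := Relation.EqvGen.setoid (fun a b => E a b ∨ E b a)
  let Q := Quotient st
  have hQ : Finite Q := inferInstance
  have hfQ : Fintype Q := Fintype.ofFinite Q
  have main : ∀ t : Finset Q, Pr K (agen (E := E) K '' {a | Quotient.mk st a ∈ t}) := by
    intro t
    induction t using Finset.induction_on with
    | empty => simpa using Pr.of_finite (K := K) (s := (∅ : Set (MonoidAlgebra K (HKMonoid E))))
                (by simp)
    | insert q t hq ih =>
      obtain ⟨v, rfl⟩ := Quotient.exists_rep q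
      have hv : Pr K (agen (E := E) K '' (comp E v)) := by
        rcases h v with h | h
        · exact Pr_acyclic K h
        · exact Pr_cycle K hcyc h
      have hcomp : ∀ a, a ∈ comp E v ↔ Quotient.mk st a = Quotient.mk st v := by
        intro a
        rw [eq_comm, Quotient.eq]; rfl
      have e : {a | Quotient.mk st a ∈ insert (Quotient.mk st v) t} =
          comp E v ∪ {a | Quotient.mk st a ∈ t} := by
        ext a
        simp [hcomp]
      rw [e, Set.image_union]
      refine hv.union ih ?_
      rintro _ ⟨a, ha, rfl⟩ _ ⟨b, hb, rfl⟩
      have hab : ¬ (E a b ∨ E b a) := by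
        intro hE
        have h1 : Quotient.mk st a = Quotient.mk st b := Quotient.sound (Relation.EqvGen.rel _ _ hE)
        rw [(hcomp a).1 ha] at h1
        exact hq (h1 ▸ hb)
      rw [not_or] at hab
      unfold agen
      rw [← map_mul, ← map_mul, gen_comm hab.1 hab.2]
  have := main Finset.univ
  simp only [Finset.mem_univ, Set.setOf_true, Set.image_univ] at this
  exact this.noeth (adjoin_agen K)

end assemble

section cyc
variable {n : ℕ}

/-- `n ≥ 3` as a class -/
class Big (n : ℕ) : Prop where
  out : 3 ≤ n

theorem one_ne [h : Big n] : (1 : ZMod n) ≠ 0 := by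
  have := h.out
  intro h
  have h2 : ((1 : ℕ) : ZMod n) = 0 := by simpa using h
  rw [ZMod.natCast_eq_zero_iff] at h2
  have := Nat.le_of_dvd (by omega) h2
  omega

theorem two_ne [h : Big n] : (1 : ZMod n) + 1 ≠ 0 := by
  have := h.out
  intro h
  have h2 : ((2 : ℕ) : ZMod n) = 0 := by
    rw [← h]; push_cast; ring
  rw [ZMod.natCast_eq_zero_iff] at h2
  have := Nat.le_of_dvd (by omega) h2
  omega

theorem cyc_irr [Big n] : ∀ v, ¬ cycE n v v := by
  intro v h
  unfold cycE at h
  have := one_ne (n := n)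
  grind

theorem cyc_as [Big n] : ∀ a b, cycE n a b → ¬ cycE n b a := by
  intro a b h h'
  unfold cycE at h h'
  have := two_ne (n := n)
  grind

theorem cyc_hc (n : ℕ) (t : ℤ) : cycE n ((t : ℤ) : ZMod n) ((t + 1 : ℤ) : ZMod n) := by
  simp [cycE]

/-- the action of the cycle monoid on the integers -/
noncomputable def act [Big n] (w : HKMonoid (cycE n)) : ℤ → ℤ :=
  pos cyc_irr cyc_as (fun t : ℤ => (t : ZMod n)) (fun t => t + 1)
    (cyc_hc n) w

variable [Big n]

theorem act_one (t : ℤ) : act (1 : HKMonoid (cycE n)) t = t := pos_one _ _ _ _ _ t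

theorem act_mul (x y : HKMonoid (cycE n)) (t : ℤ) : act (x * y) t = act y (act x t) :=
  pos_mul _ _ _ _ _ x y t

theorem act_gen (a : ZMod n) (t : ℤ) :
    act (gen (cycE n) a) t = if (t : ZMod n) = a then t + 1 else t := by
  refine (pos_gen _ _ _ _ _ a t).trans ?_
  simp only [stp]

/-- good maps -/
structure GM (n : ℕ) (f : ℤ → ℤ) : Prop where
  mono : Monotone f
  ext : ∀ t, t ≤ f t
  per : ∀ t, f (t + n) = f t + n

theorem GM_act (w : HKMonoid (cycE n)) : GM n (act w) := by
  refine ind_left (p := fun w => GM n (act w)) w ?_ ?_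
  · refine ⟨?_, ?_, ?_⟩
    · intro a b h; simpa only [act_one] using h
    · intro t; rw [act_one]
    · intro t; simp only [act_one]
  · intro a w ih
    refine ⟨monotone_int_of_le_succ ?_, ?_, ?_⟩
    · intro t
      simp only [act_mul]
      apply ih.mono
      simp only [act_gen]
      split_ifs <;> omega
    · intro t
      rw [act_mul]
      refine le_trans ?_ (ih.ext _)
      rw [act_gen]
      split_ifs <;> omega
    · intro t
      rw [act_mul, act_mul, ← ih.per]
      congr 1
      simp only [act_gen]
      push_cast
      simp only [CharP.cast_eq_zero, add_zero]
      split_ifs <;> omega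

theorem L1 (w : HKMonoid (cycE n)) : ∀ t : ℤ, act w t = act w (t + 1) →
    gen (cycE n) (t : ZMod n) * w = w := by
  refine ind_left (p := fun w => ∀ t : ℤ, act w t = act w (t + 1) →
    gen (cycE n) (t : ZMod n) * w = w) w ?_ ?_
  · intro t h
    simp only [act_one] at h
    omega
  · intro j u ih t h
    have h1 := one_ne (n := n)
    have h2 := two_ne (n := n)
    have hm := (GM_act u).mono
    rw [act_mul, act_mul, act_gen, act_gen] at h
    by_cases e1 : (t : ZMod n) = j
    · rw [e1, ← mul_assoc, gen_idem]
    · rw [if_neg e1] at h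
      push_cast at h
      by_cases e2 : (t : ZMod n) + 1 = j
      · rw [if_pos e2] at h
        have a1 := hm (show t ≤ t + 1 by omega)
        have a2 := hm (show t + 1 ≤ t + 1 + 1 by omega)
        have b1 := ih t (by omega)
        have b2 := ih (t + 1) (by omega)
        push_cast at b2
        rw [e2] at b2
        rw [b2, b1]
      · rw [if_neg e2] at h
        have b1 := ih t h
        by_cases e3 : (t : ZMod n) = j + 1
        · have hE : cycE n j (t : ZMod n) := e3
          calc gen (cycE n) (t : ZMod n) * (gen (cycE n) j * u)
              = gen (cycE n) (t : ZMod n) * gen (cycE n) j * (gen (cycE n) (t : ZMod n) * u) := by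
                rw [b1, mul_assoc]
            _ = (gen (cycE n) (t : ZMod n) * gen (cycE n) j * gen (cycE n) (t : ZMod n)) * u := by
                simp only [mul_assoc]
            _ = gen (cycE n) j * (gen (cycE n) (t : ZMod n) * u) := by
                rw [gen_bab hE, mul_assoc]
            _ = _ := by rw [b1]
        · rw [← mul_assoc, gen_comm (a := (t : ZMod n)) (b := j) (fun h => e2 h.symm) e3,
            mul_assoc, b1]

theorem L2 (w : HKMonoid (cycE n)) : ∀ a : ZMod n, (∀ t, ((act w t : ℤ) : ZMod n) ≠ a) →
    w * gen (cycE n) a = w := by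
  refine ind_right (p := fun w => ∀ a : ZMod n, (∀ t, ((act w t : ℤ) : ZMod n) ≠ a) →
    w * gen (cycE n) a = w) w ?_ ?_
  · intro a h
    obtain ⟨t, ht⟩ := ZMod.intCast_surjective a
    exact absurd (by rw [act_one, ht]) (h t)
  · intro u j ih a h
    have h1 := one_ne (n := n)
    have h2 := two_ne (n := n)
    simp only [act_mul, act_gen] at h
    by_cases e1 : a = j
    · rw [e1, mul_assoc, gen_idem]
    · by_cases e2 : a = j + 1
      · have b1 : u * gen (cycE n) j = u := ih j (by
          intro t ht
          have := h t
          rw [if_pos ht] at this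
          push_cast at this
          rw [ht] at this
          exact this e2.symm)
        rw [b1]
        refine ih a fun t ht => ?_
        have := h t
        rw [ht, if_neg e1] at this
        exact this ht
      · have b1 : u * gen (cycE n) a = u := ih a (by
          intro t ht
          have := h t
          rw [ht, if_neg e1] at this
          exact this ht)
        by_cases e3 : j = a + 1
        · have hE : cycE n a j := e3
          calc u * gen (cycE n) j * gen (cycE n) a
              = u * (gen (cycE n) a * gen (cycE n) j * gen (cycE n) a) := by
                conv_lhs => rw [← b1]
                simp only [mul_assoc]
            _ = u * gen (cycE n) a * gen (cycE n) j := by rw [gen_aba hE]; simp only [mul_assoc]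
            _ = _ := by rw [b1]
        · rw [mul_assoc, gen_comm (a := j) (b := a) e2 e3, ← mul_assoc, b1]

/-- displacement -/
def disp (n : ℕ) (f : ℤ → ℤ) : ℕ := (∑ i ∈ Finset.range n, (f i - i)).toNat

omit [Big n] in
theorem per_mul {f : ℤ → ℤ} (h : ∀ t, f (t + n) = f t + n) (t k : ℤ) :
    f (t + n * k) = f t + n * k := by
  induction k using Int.induction_on with
  | zero => simp
  | succ i ih => rw [mul_add, ← add_assoc, mul_one, h, ih]; ring
  | pred i ih =>
    have := h (t + n * (-(i : ℤ) - 1))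
    rw [show t + n * (-(i : ℤ) - 1) + n = t + n * (-(i : ℤ)) by ring, ih] at this
    linarith

theorem disp_lt {f g : ℤ → ℤ} (hf : GM n f) (hg : GM n g) (hle : ∀ t, f t ≤ g t)
    (hne : ∃ t, f t ≠ g t) : disp n f < disp n g := by
  obtain ⟨t, ht⟩ := hne
  have hn : (0 : ℤ) < n := by have := (inferInstance : Big n).out; omega
  have hf0 : 0 ≤ ∑ i ∈ Finset.range n, (f i - i) :=
    Finset.sum_nonneg fun i _ => by have := hf.ext i; omega
  have key : ∑ i ∈ Finset.range n, (f i - i) < ∑ i ∈ Finset.range n, (g i - i) := by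
    refine Finset.sum_lt_sum (fun i _ => by have := hle i; omega) ⟨(t % n).toNat, ?_, ?_⟩
    · have := Int.emod_lt_of_pos t hn
      have := Int.emod_nonneg t hn.ne'
      rw [Finset.mem_range]; omega
    · have := Int.emod_nonneg t hn.ne'
      rw [Int.toNat_of_nonneg this]
      have e := Int.emod_add_mul_ediv t n
      have a1 := per_mul hf.per (t % n) (t / n)
      have a2 := per_mul hg.per (t % n) (t / n)
      rw [e] at a1 a2
      have := hle t
      omega
  unfold disp
  omega

theorem disp_le {f g : ℤ → ℤ} (hf : GM n f) (hg : GM n g) (hle : ∀ t, f t ≤ g t) :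
    disp n f ≤ disp n g := by
  by_cases h : ∃ t, f t ≠ g t
  · exact (disp_lt hf hg hle h).le
  · push Not at h
    rw [funext h]

omit [Big n] in
theorem mod_shift {s t : ℤ} (h : (s : ZMod n) = (t : ZMod n)) : ∃ k : ℤ, s = t + n * k := by
  have := (ZMod.intCast_eq_intCast_iff_dvd_sub t s n).1 h.symm
  obtain ⟨k, hk⟩ := this
  exact ⟨k, by linarith⟩

end cyc

section cyc2
variable {n : ℕ} [Big n]

/-- the idempotent attached to a kernel -/
theorem exists_p {f : ℤ → ℤ} (hf : GM n f) : ∃ p : HKMonoid (cycE n),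
    (∀ s t, act p s = act p t ↔ f s = f t) ∧ (∀ t, act p (act p t) = act p t) ∧
    (∀ w, act w = f → p * w = w) := by
  classical
  let P : Submonoid (HKMonoid (cycE n)) :=
    Submonoid.closure {y | ∃ i : ℤ, f i = f (i + 1) ∧ y = gen (cycE n) (i : ZMod n)}
  have hP1 : ∀ q ∈ P, ∀ t, f (act q t) = f t := by
    intro q hq
    induction hq using Submonoid.closure_induction_right with
    | one => intro t; rw [act_one]
    | mul_right x _ y hy ih =>
      obtain ⟨i, hi, rfl⟩ := hy
      intro t
      rw [act_mul, act_gen]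
      split_ifs with h
      · obtain ⟨k, hk⟩ := mod_shift h
        rw [← ih t, hk, show i + n * k + 1 = (i + 1) + n * k by ring, per_mul hf.per,
          per_mul hf.per, hi]
      · exact ih t
  have hP2 : ∀ q ∈ P, ∀ w, act w = f → q * w = w := by
    intro q hq w hw
    induction hq using Submonoid.closure_induction_right with
    | one => rw [one_mul]
    | mul_right x _ y hy ih =>
      obtain ⟨i, hi, rfl⟩ := hy
      rw [mul_assoc, L1 w i (by rw [hw, hi]), ih]
  have hbd : ∀ q ∈ P, disp n (act q) ≤ disp n f := by
    intro q hq
    refine disp_le (GM_act q) hf fun t => ?_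
    rw [← hP1 q hq t]; exact hf.ext _
  obtain ⟨p, hp, hmax⟩ : ∃ p ∈ P, ∀ q ∈ P, disp n (act q) ≤ disp n (act p) := by
    let B : Set ℕ := {d | ∃ q ∈ P, disp n (act q) = d}
    have hB : B.Nonempty := ⟨_, 1, one_mem P, rfl⟩
    have hB2 : BddAbove B := ⟨disp n f, by rintro _ ⟨q, hq, rfl⟩; exact hbd q hq⟩
    obtain ⟨p, hp, e⟩ := Nat.sSup_mem hB hB2
    exact ⟨p, hp, fun q hq => by rw [e]; exact le_csSup hB2 ⟨q, hq, rfl⟩⟩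
  have hnd : ∀ t, f (act p t) < f (act p t + 1) := by
    intro t
    refine lt_of_le_of_ne (hf.mono (by omega)) fun h => ?_
    have hq : p * gen (cycE n) ((act p t : ℤ) : ZMod n) ∈ P :=
      mul_mem hp (Submonoid.subset_closure ⟨_, h, rfl⟩)
    refine absurd (hmax _ hq) (not_le.2 (disp_lt (GM_act _) (GM_act _) ?_ ⟨t, ?_⟩))
    · intro s
      rw [act_mul]; exact (GM_act _).ext _
    · rw [act_mul, act_gen, if_pos rfl]; omega
  have huniq : ∀ s t, f s = f t → f s < f (s + 1) → f t < f (t + 1) → s = t := by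
    intro s t h1 h2 h3
    rcases lt_trichotomy s t with h | h | h
    · have := hf.mono (show s + 1 ≤ t by omega); omega
    · exact h
    · have := hf.mono (show t + 1 ≤ s by omega); omega
  refine ⟨p, ?_, ?_, hP2 p hp⟩
  · intro s t
    constructor
    · intro h; rw [← hP1 p hp s, ← hP1 p hp t, h]
    · intro h
      exact huniq _ _ (by rw [hP1 p hp, hP1 p hp, h]) (hnd _) (hnd _)
  · intro t
    exact huniq _ _ (by rw [hP1 p hp]) (hnd _) (hnd _)

open Classical in
/-- push down the value class `k` -/
noncomputable def low (k : ZMod n) (h : ℤ → ℤ) : ℤ → ℤ :=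
  fun t => if (h t : ZMod n) = k then h t - 1 else h t

theorem low_pos {k : ZMod n} {h : ℤ → ℤ} {t : ℤ} (e : (h t : ZMod n) = k) :
    low k h t = h t - 1 := by simp only [low, if_pos e]

theorem low_neg {k : ZMod n} {h : ℤ → ℤ} {t : ℤ} (e : (h t : ZMod n) ≠ k) :
    low k h t = h t := by simp only [low, if_neg e]

theorem gen_pos {a : ZMod n} {t : ℤ} (e : (t : ZMod n) = a) : act (gen (cycE n) a) t = t + 1 := by
  rw [act_gen, if_pos e]

theorem gen_neg {a : ZMod n} {t : ℤ} (e : (t : ZMod n) ≠ a) : act (gen (cycE n) a) t = t := by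
  rw [act_gen, if_neg e]

theorem low_GM {h : ℤ → ℤ} (hh : GM n h) {k : ZMod n}
    (h1 : ∀ t, (h t : ZMod n) = k → t < h t) : GM n (low k h) := by
  refine ⟨?_, ?_, ?_⟩
  · intro s t hst
    have := hh.mono hst
    simp only [low]
    rcases this.eq_or_lt with h | h
    · rw [h]
    · split_ifs <;> omega
  · intro t
    have := hh.ext t
    have := h1 t
    simp only [low]
    split_ifs with h
    · have := this h; omega
    · omega
  · intro t
    simp only [low, hh.per]
    push_cast
    simp only [CharP.cast_eq_zero, add_zero]
    split_ifs <;> omega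

theorem low_ker {h : ℤ → ℤ} {k : ZMod n}
    (h2 : ∀ t, (h t : ZMod n) ≠ k - 1) (s t : ℤ) : low k h s = low k h t ↔ h s = h t := by
  constructor
  · intro e
    simp only [low] at e
    split_ifs at e with a b b
    · omega
    · exact absurd (by rw [← e]; push_cast; rw [a]) (h2 t)
    · exact absurd (by rw [e]; push_cast; rw [b]) (h2 s)
    · exact e
  · intro e
    simp only [low, e]

theorem low_gen {h : ℤ → ℤ} {k : ZMod n}
    (h2 : ∀ t, (h t : ZMod n) ≠ k - 1) (t : ℤ) :
    act (gen (cycE n) (k - 1)) (low k h t) = h t := by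
  have h1 := one_ne (n := n)
  by_cases e : (h t : ZMod n) = k
  · rw [low_pos e, gen_pos (by push_cast; rw [e])]
    omega
  · rw [low_neg e, gen_neg (h2 t)]

theorem low_disp {h : ℤ → ℤ} (hh : GM n h) {k : ZMod n}
    (h1 : ∀ t, (h t : ZMod n) = k → t < h t) (h3 : ∃ t, (h t : ZMod n) = k) :
    disp n (low k h) < disp n h := by
  obtain ⟨t, ht⟩ := h3
  refine disp_lt (low_GM hh h1) hh ?_ ⟨t, ?_⟩
  · intro t; simp only [low]; split_ifs <;> omega
  · simp only [low, if_pos ht]; omega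

theorem miss {h : ℤ → ℤ} (hh : GM n h) (hd : ∃ t, h t = h (t + 1)) :
    ∃ m, ∀ t, h t ≠ m := by
  by_contra hcon
  push Not at hcon
  obtain ⟨t0, ht0⟩ := hd
  have h1 : ∀ t, h (t + 1) ≤ h t + 1 := by
    intro t
    by_contra hlt
    obtain ⟨s, hs⟩ := hcon (h t + 1)
    rcases le_or_gt s t with h' | h'
    · have := hh.mono h'; omega
    · have := hh.mono (show t + 1 ≤ s by omega); omega
  have h2 : ∀ k : ℕ, h (t0 + 1 + k) ≤ h t0 + k := by
    intro k
    induction k with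
    | zero => simp [← ht0]
    | succ k ih =>
      have := h1 (t0 + 1 + k)
      push_cast
      rw [← add_assoc]
      omega
  have hn := (inferInstance : Big n).out
  have h3 := h2 (n - 1)
  rw [show t0 + 1 + ((n - 1 : ℕ) : ℤ) = t0 + n by omega, hh.per] at h3
  omega

theorem exists_low {h : ℤ → ℤ} (hh : GM n h) (hd : ∃ t, h t = h (t + 1))
    (hni : ∃ t, h (h t) ≠ h t) :
    ∃ k : ZMod n, (∀ t, (h t : ZMod n) = k → t < h t) ∧ (∀ t, (h t : ZMod n) ≠ k - 1) ∧
      ∃ t, (h t : ZMod n) = k := by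
  obtain ⟨m, hm⟩ := miss hh hd
  obtain ⟨t, ht⟩ := hni
  have hn := (inferInstance : Big n).out
  have key : ∀ d : ℕ, ∀ k m : ℤ, (∀ t, h t ≠ m) → k = m + d → (∃ t, h t = k) → h k ≠ k →
      ∃ k, (∃ t, h t = k) ∧ h k ≠ k ∧ ∀ t, h t ≠ k - 1 := by
    intro d
    induction d with
    | zero =>
      intro k m hm e ⟨t, ht⟩ _
      exact absurd (by rw [ht, e]; simp) (hm t)
    | succ d ih =>
      intro k m hm e hk1 hk2
      by_cases hk3 : ∃ t, h t = k - 1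
      · refine ih (k - 1) m hm (by push_cast at e; omega) hk3 fun h4 => ?_
        obtain ⟨t, ht⟩ := hk1
        have := hh.ext k
        rcases le_or_gt t (k - 1) with h' | h'
        · have := hh.mono h'; omega
        · have := hh.mono (show k ≤ t by omega); omega
      · push Not at hk3
        exact ⟨k, hk1, hk2, hk3⟩
  have hm' : ∀ j : ℤ, ∀ t, h t ≠ m - n * j := by
    intro j t e
    have := per_mul hh.per t j
    exact hm (t + n * j) (by rw [this, e]; ring)
  obtain ⟨j, hj⟩ : ∃ j : ℤ, m - n * j ≤ h t := by
    refine ⟨|m - h t|, ?_⟩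
    have : (1:ℤ) ≤ n := by omega
    have h0 := abs_nonneg (m - h t)
    have := le_abs_self (m - h t)
    nlinarith
  obtain ⟨k, ⟨s, hs⟩, hk2, hk3⟩ := key (h t - (m - n * j)).toNat (h t) (m - n * j) (hm' j)
    (by omega) ⟨t, rfl⟩ ht
  refine ⟨(k : ZMod n), ?_, ?_, ⟨s, by rw [hs]⟩⟩
  · intro u hu
    refine lt_of_le_of_ne (hh.ext u) fun e => ?_
    rw [← e] at hu
    obtain ⟨c, hc⟩ := mod_shift hu
    rw [hc, per_mul hh.per] at e
    omega
  · intro u hu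
    have : ((h u : ℤ) : ZMod n) = ((k - 1 : ℤ) : ZMod n) := by push_cast; exact hu
    obtain ⟨c, hc⟩ := mod_shift this
    have h5 := per_mul hh.per u (-c)
    exact hk3 (u + n * (-c)) (by rw [h5, hc]; ring)

theorem exist_v (p : HKMonoid (cycE n)) (hp : ∀ t, act p (act p t) = act p t)
    (hd : ∃ t, act p t = act p (t + 1)) :
    ∀ (N : ℕ) (h : ℤ → ℤ), disp n h = N → GM n h → (∀ s t, h s = h t ↔ act p s = act p t) →
      ∃ v, act (p * v) = h := by
  intro N
  induction N using Nat.strong_induction_on with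
  | _ N ih =>
    intro h hN hh hker
    by_cases hni : ∃ t, h (h t) ≠ h t
    · obtain ⟨k, k1, k2, k3⟩ := exists_low hh (by
        obtain ⟨t, ht⟩ := hd; exact ⟨t, (hker _ _).2 ht⟩) hni
      obtain ⟨v, hv⟩ := ih _ (by rw [← hN]; exact low_disp hh k1 k3) (low k h) rfl (low_GM hh k1)
        (fun s t => (low_ker k2 s t).trans (hker s t))
      refine ⟨v * gen (cycE n) (k - 1), ?_⟩
      funext t
      rw [← mul_assoc, act_mul, hv, low_gen k2]
    · push Not at hni
      refine ⟨1, ?_⟩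
      funext t
      rw [mul_one]
      have a1 := (hker _ _).1 (hni t)
      have a2 := (hker _ _).2 (hp t)
      have b1 := (GM_act p).ext (h t)
      have b2 := hh.ext (act p t)
      omega

theorem normal_w (p : HKMonoid (cycE n)) (w : HKMonoid (cycE n)) :
    (∀ s t, act (p * w) s = act (p * w) t → act p s = act p t) →
    p * w = p ∨ ∃ w0 j, p * w = p * w0 * gen (cycE n) j ∧
      (∀ s t, act (p * w0) s = act (p * w0) t ↔ act p s = act p t) ∧
      (∃ t, (act (p * w0) t : ZMod n) = j) ∧ (∀ t, (act (p * w0) t : ZMod n) ≠ j + 1) := by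
  refine ind_right (p := fun w => (∀ s t, act (p * w) s = act (p * w) t → act p s = act p t) →
    p * w = p ∨ ∃ w0 j, p * w = p * w0 * gen (cycE n) j ∧
      (∀ s t, act (p * w0) s = act (p * w0) t ↔ act p s = act p t) ∧
      (∃ t, (act (p * w0) t : ZMod n) = j) ∧ (∀ t, (act (p * w0) t : ZMod n) ≠ j + 1)) w ?_ ?_
  · intro _; left; rw [mul_one]
  · intro w0 j ih hk
    have hk0 : ∀ s t, act (p * w0) s = act (p * w0) t ↔ act p s = act p t := by
      intro s t
      constructor
      · intro e
        apply hk
        rw [← mul_assoc, act_mul, e, ← act_mul]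
      · intro e; rw [act_mul, e, ← act_mul]
    by_cases hj : ∃ t, (act (p * w0) t : ZMod n) = j
    · right
      refine ⟨w0, j, by rw [mul_assoc], hk0, hj, ?_⟩
      intro t ht
      obtain ⟨s, hs⟩ := hj
      have : ((act (p * w0) t : ℤ) : ZMod n) = ((act (p * w0) s + 1 : ℤ) : ZMod n) := by
        push_cast; rw [ht, hs]
      obtain ⟨c, hc⟩ := mod_shift this
      have h5 := per_mul (GM_act (p * w0)).per s c
      have h1 := one_ne (n := n)
      have e : act (p * (w0 * gen (cycE n) j)) t = act (p * (w0 * gen (cycE n) j)) (s + n * c) := by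
        rw [← mul_assoc, act_mul (p * w0), act_mul (p * w0), h5, gen_neg, gen_pos, hc]
        · ring
        · push_cast; simp [hs]
        · rw [ht]; grind
      have e2 := (hk0 _ _).2 (hk _ _ e)
      rw [h5, hc] at e2
      omega
    · push Not at hj
      have := L2 (p * w0) j hj
      rw [← mul_assoc, this]
      exact ih fun s t e => (hk0 s t).1 e

theorem step_info {g : ℤ → ℤ} {j : ZMod n} (h1 : ∃ t, (g t : ZMod n) = j)
    (h2 : ∀ t, (g t : ZMod n) ≠ j + 1) {f : ℤ → ℤ}
    (hf : ∀ t, f t = act (gen (cycE n) j) (g t)) :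
    (∀ t, (f t : ZMod n) ≠ j) ∧ (∃ t, (f t : ZMod n) = j + 1) ∧ g = low (j + 1) f := by
  have h3 := one_ne (n := n)
  refine ⟨?_, ?_, ?_⟩
  · intro t
    rw [hf, act_gen]
    split_ifs with h
    · push_cast; rw [h]; grind
    · exact h
  · obtain ⟨t, ht⟩ := h1
    refine ⟨t, ?_⟩
    rw [hf, act_gen, if_pos ht]; push_cast; rw [ht]
  · funext t
    simp only [low, hf, act_gen]
    by_cases h : (g t : ZMod n) = j
    · rw [if_pos h, if_pos (by push_cast; rw [h])]; omega
    · rw [if_neg h, if_neg (h2 t)]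

theorem uniq_w (p : HKMonoid (cycE n)) (hp : ∀ t, act p (act p t) = act p t)
    (hd : ∃ t, act p t = act p (t + 1)) :
    ∀ (N : ℕ) (w w' : HKMonoid (cycE n)), disp n (act (p * w)) = N →
      act (p * w) = act (p * w') → 
      (∀ s t, act (p * w) s = act (p * w) t → act p s = act p t) → p * w = p * w' := by
  intro N
  induction N using Nat.strong_induction_on with
  | _ N ih =>
    intro w w' hN hww hk
    have dl : ∀ u j, (∃ t, (act (p * u) t : ZMod n) = j) →
        disp n (act (p * u)) < disp n (act (p * u * gen (cycE n) j)) := by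
      intro u j ⟨t, ht⟩
      refine disp_lt (GM_act _) (GM_act _) ?_ ⟨t, ?_⟩
      · intro t; rw [act_mul _ (gen (cycE n) j)]; exact (GM_act _).ext _
      · rw [act_mul _ (gen (cycE n) j), act_gen, if_pos ht]; omega
    have dp : ∀ u, disp n (act p) ≤ disp n (act (p * u)) := by
      intro u
      refine disp_le (GM_act _) (GM_act _) fun t => ?_
      rw [act_mul]; exact (GM_act _).ext _
    rcases normal_w p w hk with h | ⟨w0, j, e, k0, j1, j2⟩
    · rcases normal_w p w' (by rw [← hww]; exact hk) with h' | ⟨w0', j', e', k0', j1', j2'⟩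
      · rw [h, h']
      · have := dl w0' j' j1'
        rw [← e', ← hww, h] at this
        exact absurd (dp w0') (not_le.2 this)
    · rcases normal_w p w' (by rw [← hww]; exact hk) with h' | ⟨w0', j', e', k0', j1', j2'⟩
      · have := dl w0 j j1
        rw [← e, hww, h'] at this
        exact absurd (dp w0) (not_le.2 this)
      · have d0 := dl w0 j j1
        have d0' := dl w0' j' j1'
        rw [← e, hN] at d0
        rw [← e', ← hww, hN] at d0'
        obtain ⟨a1, a2, a3⟩ := step_info j1 j2 (f := act (p * w)) (by intro t; rw [e, act_mul])
        obtain ⟨b1, b2, b3⟩ := step_info j1' j2' (f := act (p * w)) (by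
          intro t; rw [hww, e', act_mul])
        rw [e, e']
        by_cases hj : j = j'
        · subst hj
          rw [ih _ d0 w0 w0' rfl (by rw [a3, b3]) (fun s t => (k0 s t).1)]
        · set f := act (p * w) with hfdef
          have h3 := one_ne (n := n)
          have c1 : j' ≠ j + 1 := by
            rintro rfl
            obtain ⟨t, ht⟩ := a2
            exact b1 t ht
          have c2 : j ≠ j' + 1 := by
            rintro rfl
            obtain ⟨t, ht⟩ := b2
            exact a1 t ht
          have l1 : ∀ t, (act (p * w0) t : ZMod n) ≠ j' + 1 - 1 := by
            intro t
            have := b1 t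
            rw [a3]; simp only [low]
            split_ifs with h
            · push_cast; rw [h]; grind
            · grind
          have l2 : ∀ t, (act (p * w0) t : ZMod n) = j' + 1 → t < act (p * w0) t := by
            intro t ht
            have h5 : act (p * w0) t = f t := by
              rw [a3] at ht ⊢; simp only [low] at ht ⊢
              split_ifs at ht ⊢ with h
              · exfalso
                push_cast at ht; rw [h] at ht; apply c2; rw [← ht]; ring
              · rfl
            rw [h5] at ht ⊢
            have := (GM_act (p * w0')).ext t
            rw [b3] at this
            simp only [low, if_pos ht] at this
            omega
          obtain ⟨v, hv⟩ := exist_v p hp hd _ (low (j' + 1) (act (p * w0))) rfl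
            (low_GM (GM_act _) l2) (fun s t => (low_ker l1 s t).trans (k0 s t))
          have g1 : act (p * w0) = act (p * (v * gen (cycE n) j')) := by
            funext t
            rw [← mul_assoc p v, act_mul (p * v), hv]
            have := low_gen l1 t
            rw [add_sub_cancel_right] at this
            exact this.symm
          have g2 : act (p * w0') = act (p * (v * gen (cycE n) j)) := by
            funext t
            rw [← mul_assoc p v, act_mul (p * v), hv, b3]
            have x1 := a1 t
            have x2 := b1 t
            have a3t := congrFun a3 t
            by_cases y1 : (f t : ZMod n) = j + 1
            · have y2 : (f t : ZMod n) ≠ j' + 1 := by grind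
              have y3 : ((f t - 1 : ℤ) : ZMod n) = j := by push_cast; rw [y1]; ring
              rw [low_pos y1] at a3t
              rw [low_neg y2, low_neg (h := act (p * w0)) (by rw [a3t, y3]; exact c2), a3t,
                gen_pos y3]
              omega
            · rw [low_neg y1] at a3t
              by_cases y2 : (f t : ZMod n) = j' + 1
              · have y3 : ((f t - 1 : ℤ) : ZMod n) = j' := by push_cast; rw [y2]; ring
                rw [low_pos y2, low_pos (h := act (p * w0)) (by rw [a3t, y2]), a3t,
                  gen_neg (by rw [y3]; exact fun h => hj h.symm)]
              · rw [low_neg y2, low_neg (h := act (p * w0)) (by rw [a3t]; exact y2), a3t,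
                  gen_neg x1]
          have r1 := ih _ d0 w0 (v * gen (cycE n) j') rfl g1 (fun s t => (k0 s t).1)
          have r2 := ih _ d0' w0' (v * gen (cycE n) j) rfl g2 (fun s t => (k0' s t).1)
          rw [r1, r2]
          simp only [mul_assoc]
          rw [gen_comm (a := j') (b := j) c2 c1]

theorem desc_of_ne_one (w : HKMonoid (cycE n)) : w = 1 ∨ ∃ t, act w t = act w (t + 1) := by
  refine ind_left (p := fun w => w = 1 ∨ ∃ t, act w t = act w (t + 1)) w (Or.inl rfl) ?_
  intro a w _
  right
  obtain ⟨t, rfl⟩ := ZMod.intCast_surjective a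
  refine ⟨t, ?_⟩
  have h3 := one_ne (n := n)
  rw [act_mul, act_mul, act_gen, act_gen, if_pos rfl, if_neg]
  intro h
  apply h3
  simpa using h

theorem act_inj {w w' : HKMonoid (cycE n)} (h : act w = act w') : w = w' := by
  rcases desc_of_ne_one w with h1 | hd
  · rcases desc_of_ne_one w' with h2 | ⟨t, ht⟩
    · rw [h1, h2]
    · rw [← h, h1] at ht
      simp only [act_one] at ht
      omega
  · obtain ⟨p, p1, p2, p3⟩ := exists_p (GM_act w)
    have e1 := p3 w rfl
    have e2 := p3 w' h.symm
    have := uniq_w p p2 (by obtain ⟨t, ht⟩ := hd; exact ⟨t, (p1 _ _).2 ht⟩) _ w w' rfl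
      (by rw [e1, e2, h]) (by intro s t hst; rw [e1] at hst; exact (p1 _ _).2 hst)
    rwa [e1, e2] at this

theorem realize {f : ℤ → ℤ} (hf : GM n f) (hd : ∃ t, f t = f (t + 1)) :
    ∃ w : HKMonoid (cycE n), act w = f := by
  obtain ⟨p, p1, p2, p3⟩ := exists_p hf
  obtain ⟨v, hv⟩ := exist_v p p2 (by obtain ⟨t, ht⟩ := hd; exact ⟨t, (p1 _ _).2 ht⟩) _ f rfl hf
    (fun s t => (p1 s t).symm)
  exact ⟨_, hv⟩

end cyc2

section cyc3
variable {n : ℕ} [Big n]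

open Classical in
/-- the shifted maps used for the central-like element -/
noncomputable def dD (D : Finset (ZMod n)) : ℤ → ℤ :=
  fun t => (if (t : ZMod n) ∈ D then t - 1 else t) + n

theorem dD_GM (D : Finset (ZMod n)) : GM n (dD D) := by
  have hn := (inferInstance : Big n).out
  refine ⟨monotone_int_of_le_succ ?_, ?_, ?_⟩
  · intro t
    simp only [dD]
    split_ifs <;> omega
  · intro t
    simp only [dD]
    split_ifs <;> omega
  · intro t
    simp only [dD]
    push_cast
    simp only [CharP.cast_eq_zero, add_zero]
    split_ifs <;> omega

theorem dD_desc (D : Finset (ZMod n)) (h1 : D.Nonempty) (h2 : ∃ x, x ∉ D) :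
    ∃ t, dD D t = dD D (t + 1) := by
  obtain ⟨y, hy⟩ := h1
  obtain ⟨x, hx⟩ := h2
  obtain ⟨s, hs⟩ : ∃ s : ℤ, (s : ZMod n) ∉ D ∧ ((s + 1 : ℤ) : ZMod n) ∈ D := by
    by_contra hcon
    push Not at hcon
    obtain ⟨s, rfl⟩ := ZMod.intCast_surjective x
    have key : ∀ k : ℕ, ((s + k : ℤ) : ZMod n) ∉ D := by
      intro k
      induction k with
      | zero => simpa using hx
      | succ k ih =>
        have := hcon _ ih
        rwa [add_assoc] at this
    haveI : NeZero n := ⟨by have := (inferInstance : Big n).out; omega⟩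
    apply key ((y - (s : ZMod n)).val)
    push_cast
    rw [ZMod.natCast_val, ZMod.cast_id', id]
    rwa [add_sub_cancel]
  refine ⟨s, ?_⟩
  simp only [dD, if_neg hs.1, if_pos hs.2]
  omega

/-- words that are not far -/
def near (n : ℕ) [Big n] : Set (HKMonoid (cycE n)) := {w | ∃ i, act w i < i + n}

theorem near_finite : (near n).Finite := by
  have hn := (inferInstance : Big n).out
  let F : HKMonoid (cycE n) → (Fin n → ℤ) := fun w i => act w (i : ℕ)
  have hF : Function.Injective F := by
    intro w w' h
    apply act_inj
    funext t
    have hn' : (0:ℤ) < n := by omega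
    have a0 := Int.emod_nonneg t hn'.ne'
    have a1 := Int.emod_lt_of_pos t hn'
    have := congrFun h ⟨(t % n).toNat, by omega⟩
    simp only [F] at this
    rw [Int.toNat_of_nonneg a0] at this
    have e := Int.emod_add_mul_ediv t n
    have b1 := per_mul (GM_act w).per (t % n) (t / n)
    have b2 := per_mul (GM_act w').per (t % n) (t / n)
    rw [e] at b1 b2
    rw [b1, b2, this]
  refine Set.Finite.of_finite_image (f := F) (Set.Finite.subset
    (Set.Finite.pi' (t := fun _ : Fin n => Set.Icc (0:ℤ) (3 * n)) fun _ => Set.finite_Icc _ _) ?_)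
    hF.injOn
  rintro _ ⟨w, ⟨i, hi⟩, rfl⟩ j
  have hg := GM_act w
  have hn' : (0:ℤ) < n := by omega
  have a0 := Int.emod_nonneg i hn'.ne'
  have a1 := Int.emod_lt_of_pos i hn'
  have e := Int.emod_add_mul_ediv i n
  have b1 := per_mul hg.per (i % n) (i / n)
  rw [e] at b1
  have b2 := hg.ext (j : ℕ)
  have hj := j.2
  have b3 := hg.mono (show ((j : ℕ) : ℤ) ≤ i % n + n by omega)
  rw [hg.per] at b3
  simp only [F, Set.mem_Icc]
  constructor <;> omega

theorem cyc_Pr_aux (K : Type*) [Field K] : Pr K (Set.range (agen (E := cycE n) K)) := by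
  classical
  have hn := (inferInstance : Big n).out
  haveI : NeZero n := ⟨by omega⟩
  unfold Pr
  rw [adjoin_agen]
  have hg : ∀ D : Finset (ZMod n), ∃ g : HKMonoid (cycE n),
      D.Nonempty → (∃ x, x ∉ D) → act g = dD D := by
    intro D
    by_cases h : D.Nonempty ∧ (∃ x, x ∉ D)
    · obtain ⟨g, hg⟩ := realize (dD_GM D) (dD_desc D h.1 h.2)
      exact ⟨g, fun _ _ => hg⟩
    · exact ⟨1, fun h1 h2 => absurd ⟨h1, h2⟩ h⟩
  choose g hg using hg
  let o : HKMonoid (cycE n) → MonoidAlgebra K (HKMonoid (cycE n)) := fun w => MonoidAlgebra.of K _ w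
  have o_mul : ∀ x y, o (x * y) = o x * o y := fun x y => map_mul _ x y
  let I : Finset (Finset (ZMod n)) := Finset.univ.filter fun D => D.Nonempty ∧ ∃ x, x ∉ D
  let z : MonoidAlgebra K (HKMonoid (cycE n)) := ∑ D ∈ I, (-(-1 : K) ^ D.card) • o (g D)
  let C : Subalgebra K (MonoidAlgebra K (HKMonoid (cycE n))) := Algebra.adjoin K {z}
  let N : Submodule K (MonoidAlgebra K (HKMonoid (cycE n))) := Submodule.span K (o '' near n)
  have hzC : z ∈ C := Algebra.subset_adjoin rfl
  have hmulz : ∀ x ∈ Subalgebra.toSubmodule C * N, z * x ∈ Subalgebra.toSubmodule C * N := by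
    intro x hx
    induction hx using Submodule.mul_induction_on' with
    | mem_mul_mem c hc m hm =>
      rw [← mul_assoc]
      exact Submodule.mul_mem_mul (Subalgebra.mul_mem C hzC hc) hm
    | add x _ y _ hx hy => rw [mul_add]; exact add_mem hx hy
  have key : ∀ (N' : ℕ) (w : HKMonoid (cycE n)), disp n (act w) = N' →
      o w ∈ Subalgebra.toSubmodule C * N := by
    intro N'
    induction N' using Nat.strong_induction_on with
    | _ N' ih =>
      intro w hw
      by_cases hnear : w ∈ near n
      · have := Submodule.mul_mem_mul (M := Subalgebra.toSubmodule C) (N := N)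
          (Subalgebra.one_mem C) (Submodule.subset_span ⟨w, hnear, rfl⟩)
        rwa [one_mul] at this
      · have hfar : ∀ i, i + n ≤ act w i := by
          intro i; by_contra h; exact hnear ⟨i, by omega⟩
        have hgw := GM_act w
        let f' : ℤ → ℤ := fun t => act w t - n
        have hf' : GM n f' := by
          refine ⟨?_, ?_, ?_⟩
          · intro s t h; have := hgw.mono h; simp only [f']; omega
          · intro t; have := hfar t; simp only [f']; omega
          · intro t; simp only [f']; rw [hgw.per]; ring
        have hd : ∃ t, act w t = act w (t + 1) := by
          rcases desc_of_ne_one w with h | h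
          · exfalso
            have := hfar 0
            rw [h, act_one] at this
            omega
          · exact h
        obtain ⟨w', hw'⟩ := realize (n := n) hf' (by
          obtain ⟨t, ht⟩ := hd; exact ⟨t, by simp only [f', ht]⟩)
        have dw' : disp n (act w') < N' := by
          rw [← hw]
          refine disp_lt (GM_act _) hgw ?_ ⟨0, ?_⟩
          · intro t; rw [hw']; simp only [f']; omega
          · rw [hw']; simp only [f']; omega
        have hprod : ∀ D ∈ I, ∀ t, act (g D * w') t = act w (if (t : ZMod n) ∈ D then t - 1 else t) := by
          intro D hD t
          have hD' := (Finset.mem_filter.1 hD).2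
          rw [act_mul, hw', hg D hD'.1 hD'.2]
          simp only [f', dD]
          rw [hgw.per]
          ring
        let De : Finset (ZMod n) := Finset.univ.filter fun c =>
          ∀ t : ℤ, (t : ZMod n) = c → act w (t - 1) = act w t
        have hsub : ∀ D ∈ I, D ⊆ De → g D * w' = w := by
          intro D hD hDe
          apply act_inj
          funext t
          rw [hprod D hD]
          split_ifs with h
          · exact (Finset.mem_filter.1 (hDe h)).2 t rfl
          · rfl
        have hnsub : ∀ D ∈ I, ¬ D ⊆ De → disp n (act (g D * w')) < N' := by
          intro D hD hDe
          rw [Finset.not_subset] at hDe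
          obtain ⟨c, hc, hcD⟩ := hDe
          have : ∃ t : ℤ, (t : ZMod n) = c ∧ act w (t - 1) ≠ act w t := by
            by_contra hcon
            push Not at hcon
            exact hcD (Finset.mem_filter.2 ⟨Finset.mem_univ _, hcon⟩)
          obtain ⟨t, rfl, ht⟩ := this
          rw [← hw]
          refine disp_lt (GM_act _) hgw ?_ ⟨t, ?_⟩
          · intro t
            rw [hprod D hD]
            apply hgw.mono
            split_ifs <;> omega
          · rw [hprod D hD, if_pos hc]; exact ht
        have hDe1 : De.Nonempty := by
          obtain ⟨t, ht⟩ := hd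
          refine ⟨((t + 1 : ℤ) : ZMod n), Finset.mem_filter.2 ⟨Finset.mem_univ _, ?_⟩⟩
          intro s hs
          obtain ⟨k, hk⟩ := mod_shift hs
          rw [hk, show t + 1 + n * k - 1 = t + n * k by ring, per_mul hgw.per, per_mul hgw.per, ht]
        have hDe2 : ∃ x, x ∉ De := by
          by_contra hcon
          push Not at hcon
          have h1 : ∀ k : ℕ, act w k = act w 0 := by
            intro k
            induction k with
            | zero => rfl
            | succ k ih =>
              have := (Finset.mem_filter.1 (hcon ((k + 1 : ℕ) : ZMod n))).2 ((k + 1 : ℕ) : ℤ)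
                (by push_cast; rfl)
              rw [← this, ← ih]
              push_cast
              congr 1
              ring
          have h2 := h1 n
          have h3 := hgw.per 0
          rw [zero_add] at h3
          omega
        have hIs : I.filter (fun D => D ⊆ De) = De.powerset.erase ∅ := by
          ext D
          simp only [I, Finset.mem_filter, Finset.mem_univ, true_and, Finset.mem_erase,
            Finset.mem_powerset]
          constructor
          · rintro ⟨⟨h1, _⟩, h3⟩; exact ⟨h1.ne_empty, h3⟩
          · rintro ⟨h1, h3⟩
            obtain ⟨x, hx⟩ := hDe2
            exact ⟨⟨Finset.nonempty_iff_ne_empty.2 h1, x, fun h => hx (h3 h)⟩, h3⟩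
        have hsum : ∑ D ∈ I.filter (fun D => D ⊆ De), (-(-1 : K) ^ D.card) = 1 := by
          rw [hIs]
          have h0 : ∑ D ∈ De.powerset, (-1 : K) ^ D.card = 0 := by
            have := Finset.sum_powerset_neg_one_pow_card_of_nonempty hDe1
            have h' := congrArg (Int.cast : ℤ → K) this
            push_cast at h'
            exact h'
          rw [← Finset.add_sum_erase _ _ (Finset.empty_mem_powerset De)] at h0
          rw [Finset.sum_neg_distrib]
          simp only [Finset.card_empty, pow_zero] at h0
          linear_combination -h0
        have hz : z * o w' = o w + ∑ D ∈ I.filter (fun D => ¬ D ⊆ De),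
            (-(-1 : K) ^ D.card) • o (g D * w') := by
          have e1 : z * o w' = ∑ D ∈ I, (-(-1 : K) ^ D.card) • o (g D * w') := by
            simp only [z, Finset.sum_mul, o_mul, smul_mul_assoc]
          rw [e1, ← Finset.sum_filter_add_sum_filter_not I (fun D => D ⊆ De)]
          congr 1
          calc _ = ∑ D ∈ I.filter (fun D => D ⊆ De), (-(-1 : K) ^ D.card) • o w := by
                refine Finset.sum_congr rfl fun D hD => ?_
                rw [hsub D (Finset.mem_filter.1 hD).1 (Finset.mem_filter.1 hD).2]
            _ = _ := by rw [← Finset.sum_smul, hsum, one_smul]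
        rw [← sub_eq_iff_eq_add] at hz
        rw [← hz]
        refine sub_mem (hmulz _ (ih _ dw' w' rfl)) (Submodule.sum_mem _ fun D hD => ?_)
        refine Submodule.smul_mem _ _ (ih _ ?_ _ rfl)
        exact hnsub D (Finset.mem_filter.1 hD).1 (Finset.mem_filter.1 hD).2
  refine ⟨C, le_top, ?_, ⟨{z}, by simp [C]⟩, N, ?_, Submodule.fg_span (near_finite.image _), ?_⟩
  · have : C ≤ Subalgebra.centralizer K (Subalgebra.centralizer K {z} : Set (MonoidAlgebra K (HKMonoid (cycE n)))) := by
      refine Algebra.adjoin_le ?_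
      rintro _ rfl
      rw [SetLike.mem_coe, Subalgebra.mem_centralizer_iff]
      intro y hy
      exact ((Subalgebra.mem_centralizer_iff K).1 hy z rfl).symm
    have h2 : C ≤ Subalgebra.centralizer K {z} := by
      refine Algebra.adjoin_le ?_
      rintro _ rfl
      rw [SetLike.mem_coe, Subalgebra.mem_centralizer_iff]
      rintro y rfl
      rfl
    intro x hx y hy
    exact ((Subalgebra.mem_centralizer_iff K).1 (this hy) x (h2 hx))
  · intro x _; trivial
  · intro x _
    induction x using MonoidAlgebra.induction_linear with
    | zero => exact zero_mem _
    | add x y hx hy => exact add_mem (hx trivial) (hy trivial)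
    | single a b =>
      have : MonoidAlgebra.single a b = b • o a := by
        simp only [o, MonoidAlgebra.of_apply, MonoidAlgebra.smul_single, smul_eq_mul, mul_one]
      rw [this]
      exact Submodule.smul_mem _ _ (key _ a rfl)

end cyc3

theorem cyc_Pr (K : Type*) [Field K] (n : ℕ) (h : 3 ≤ n) :
    Pr K (Set.range (agen (E := cycE n) K)) := by
  haveI : Big n := ⟨h⟩
  exact cyc_Pr_aux K

section final
variable {V : Type*} {E : V → V → Prop}

theorem comp_flip (v : V) : comp (flip E) v = comp E v := by
  unfold comp flip
  have : (fun a b => E b a ∨ E a b) = (fun a b => E a b ∨ E b a) := by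
    funext a b; exact propext or_comm
  rw [this]

theorem acyclic_flip {S : Set V} (h : AcyclicOn E S) : AcyclicOn (flip E) S := by
  rintro ⟨m, c, h1, h2, h3, h4⟩
  refine h ⟨m, fun t => c (m - t), h1, ?_, ?_, ?_⟩
  · simp [h2]
  · intro t _; exact h3 _ (by omega)
  · intro t ht
    have := h4 (m - (t + 1)) (by omega)
    rw [show m - (t + 1) + 1 = m - t by omega] at this
    exact this

theorem cycle_flip {S : Set V} (h : IsCycleOn E S) : IsCycleOn (flip E) S := by
  obtain ⟨m, hm, φ, hφ⟩ := h
  refine ⟨m, hm, φ.trans (Equiv.neg _), ?_⟩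
  intro v w
  change E w v ↔ - φ w = - φ v + 1
  rw [hφ]
  constructor
  · intro h; rw [h]; ring
  · intro h; linear_combination h

theorem cond_flip (h : ∀ v : V, AcyclicOn E (comp E v) ∨ IsCycleOn E (comp E v)) :
    ∀ v : V, AcyclicOn (flip E) (comp (flip E) v) ∨ IsCycleOn (flip E) (comp (flip E) v) := by
  intro v
  rw [comp_flip]
  exact (h v).imp acyclic_flip cycle_flip

end final

/-- Theorem 5.6 (Noetherian): for a finite simple oriented graph `Θ = (V, E)`,
`K[HK_Θ]` is right Noetherian iff it is left Noetherian iff every connected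
component of `Θ` is an oriented cycle or acyclic. (Right Noetherian means the
opposite ring is Noetherian.) -/
theorem stmt18 (V : Type*) [Fintype V] (E : V → V → Prop)
    (hirr : ∀ v, ¬ E v v) (hsimple : ∀ v w, v ≠ w → E v w → ¬ E w v)
    (K : Type*) [Field K] :
    (IsNoetherianRing (MonoidAlgebra K (HKMonoid E))ᵐᵒᵖ ↔
      ∀ v : V, AcyclicOn E (comp E v) ∨ IsCycleOn E (comp E v)) ∧
    (IsNoetherianRing (MonoidAlgebra K (HKMonoid E)) ↔
      ∀ v : V, AcyclicOn E (comp E v) ∨ IsCycleOn E (comp E v)) := by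
  have hs : ∀ a b, E a b → ¬ E b a := by
    intro a b h
    refine hsimple a b ?_ h
    rintro rfl
    exact hirr _ h
  constructor
  · rw [noeth_op_iff]
    constructor
    · intro hN v
      have hN' := cond_of_noeth (E := flip E) hirr (fun a b h => hs b a h) K hN
      exact cond_flip (E := flip E) hN' v
    · intro h
      exact noeth_of_cond K (cyc_Pr K) (cond_flip h)
  · exact ⟨fun hN v => cond_of_noeth hirr hs K hN v, fun h => noeth_of_cond K (cyc_Pr K) h⟩

end HK
end
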